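/- arXiv:2309.07534 — 9 statements merged into one kernel-verified Lean document; each statement's English description precedes it below -/
import Mathlib

section
/- Let p be a prime and n ≥ 1 an integer. For every y ∈ GL_n(ℚ_p) there exist a permutation matrix w, integers r_1, …, r_n, an upper-triangular matrix u ∈ GL_n(ℚ_p) with all diagonal entries equal to 1, and k ∈ GL_n(ℤ_p) such that, setting t := diag(p^{r_1}, …, p^{r_n}) and b := t·u, the following hold: (i) w·y = t·u·k; (ii) t·u·t^{−1} ∈ GL_n(ℤ_p); (iii) for every 1 ≤ i ≤ n and all indices 1 ≤ i′, j′ ≤ i with b_{i′j′} ≠ 0 one has v_p(b_{ii}) ≤ v_p(b_{i′j′}). In particular y ∈ GL_n(ℤ_p)·t·GL_n(ℤ_p). -/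
open Matrix

/-- Membership in `GL_m(ℤ_p)`: all entries are `p`-adic integers and the determinant is a
`p`-adic unit. -/
def IsGLZ (p : ℕ) [Fact p.Prime] {ι : Type*} [Fintype ι] [DecidableEq ι]
    (g : Matrix ι ι ℚ_[p]) : Prop :=
  (∀ i j, ‖g i j‖ ≤ 1) ∧ ‖g.det‖ = 1

/-- The permutation matrix attached to a permutation `σ`. -/
noncomputable def permMat (p : ℕ) [Fact p.Prime] {ι : Type*} [DecidableEq ι] (σ : Equiv.Perm ι) :
    Matrix ι ι ℚ_[p] :=
  Matrix.of (fun i j => if i = σ j then 1 else 0)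

lemma isGLZ_iff_exists_map (p : ℕ) [Fact p.Prime] {ι : Type*} [Fintype ι] [DecidableEq ι]
    (g : Matrix ι ι ℚ_[p]) :
    IsGLZ p g ↔ ∃ G : Matrix ι ι ℤ_[p], IsUnit G.det ∧ G.map PadicInt.Coe.ringHom = g := by
  have hdet : ∀ G : Matrix ι ι ℤ_[p],
      (G.map PadicInt.Coe.ringHom).det = ((G.det : ℤ_[p]) : ℚ_[p]) := fun G =>
    (RingHom.map_det PadicInt.Coe.ringHom G).symm
  constructor
  · rintro ⟨h1, h2⟩
    obtain ⟨G, hg⟩ : ∃ G : Matrix ι ι ℤ_[p], G.map PadicInt.Coe.ringHom = g :=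
      ⟨Matrix.of fun i j => ⟨g i j, h1 i j⟩, rfl⟩
    refine ⟨G, ?_, hg⟩
    rw [PadicInt.isUnit_iff, PadicInt.norm_def, ← hdet, hg, h2]
  · rintro ⟨G, hG, rfl⟩
    refine ⟨fun i j => (G i j).2, ?_⟩
    rw [hdet, ← PadicInt.norm_def, ← PadicInt.isUnit_iff]
    exact hG

lemma IsGLZ.mul {p : ℕ} [Fact p.Prime] {ι : Type*} [Fintype ι] [DecidableEq ι]
    {g h : Matrix ι ι ℚ_[p]} (hg : IsGLZ p g) (hh : IsGLZ p h) : IsGLZ p (g * h) := by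
  rw [isGLZ_iff_exists_map] at *
  obtain ⟨G, hG, rfl⟩ := hg
  obtain ⟨H, hH, rfl⟩ := hh
  exact ⟨G * H, by rw [det_mul]; exact hG.mul hH, Matrix.map_mul⟩

lemma IsGLZ.isUnit_det {p : ℕ} [Fact p.Prime] {ι : Type*} [Fintype ι] [DecidableEq ι]
    {g : Matrix ι ι ℚ_[p]} (hg : IsGLZ p g) : IsUnit g.det := by
  rw [isUnit_iff_ne_zero, ← norm_ne_zero_iff, hg.2]
  exact one_ne_zero

lemma IsGLZ.inv {p : ℕ} [Fact p.Prime] {ι : Type*} [Fintype ι] [DecidableEq ι]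
    {g : Matrix ι ι ℚ_[p]} (hg : IsGLZ p g) : IsGLZ p g⁻¹ := by
  rw [isGLZ_iff_exists_map] at *
  obtain ⟨G, hG, rfl⟩ := hg
  refine ⟨G⁻¹, by simpa using hG, ?_⟩
  symm
  apply Matrix.inv_eq_left_inv
  rw [← Matrix.map_mul, Matrix.nonsing_inv_mul _ hG]
  exact Matrix.map_one _ (map_zero _) (map_one _)

lemma IsGLZ.submatrix {p : ℕ} [Fact p.Prime] {ι : Type*} [Fintype ι] [DecidableEq ι]
    {g : Matrix ι ι ℚ_[p]} (hg : IsGLZ p g) (σ τ : Equiv.Perm ι) :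
    IsGLZ p (g.submatrix σ τ) := by
  have hsign : ∀ ρ : Equiv.Perm ι, ‖(((Equiv.Perm.sign ρ : ℤˣ) : ℤ) : ℚ_[p])‖ = 1 := fun ρ => by
    rcases Int.units_eq_one_or (Equiv.Perm.sign ρ) with h | h <;> simp [h]
  refine ⟨fun i j => hg.1 _ _, ?_⟩
  have : g.submatrix σ τ = (g.submatrix σ id).submatrix id τ := rfl
  rw [this, det_permute', det_permute, norm_mul, norm_mul, hg.2, hsign, hsign]
  norm_num

lemma isGLZ_one (p : ℕ) [Fact p.Prime] {ι : Type*} [Fintype ι] [DecidableEq ι] :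
    IsGLZ p (1 : Matrix ι ι ℚ_[p]) :=
  (isGLZ_iff_exists_map p 1).2 ⟨1, by simp, Matrix.map_one _ (map_zero _) (map_one _)⟩

lemma permMat_mul (p : ℕ) [Fact p.Prime] {ι : Type*} [Fintype ι] [DecidableEq ι]
    (σ : Equiv.Perm ι) (y : Matrix ι ι ℚ_[p]) :
    permMat p σ * y = y.submatrix σ.symm id := by
  ext i j
  simp [permMat, Matrix.mul_apply, ← Equiv.symm_apply_eq]

lemma swap_apply_le {α : Type*} [LinearOrder α] {a m i I : α} (ha : a ≤ m) (hm : m ≤ I)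
    (hi : i ≤ I) : Equiv.swap a m i ≤ I := by
  rw [Equiv.swap_apply_def]
  split_ifs
  exacts [hm, ha.trans hm, hi]

lemma swap_apply_lt {α : Type*} [LinearOrder α] {a m i I : α} (ha : a ≤ m) (hm : m < I)
    (hi : i < I) : Equiv.swap a m i < I := by
  rw [Equiv.swap_apply_def]
  split_ifs
  exacts [hm, ha.trans_lt hm, hi]

lemma swap_apply_of_gt {α : Type*} [LinearOrder α] {a m I : α} (ha : a ≤ m) (hm : m < I) :
    Equiv.swap a m I = I :=
  Equiv.swap_apply_of_ne_of_ne (ne_of_gt (ha.trans_lt hm)) (ne_of_gt hm)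

/-- Row `i` vanishes to the left of the diagonal, its diagonal entry is a power of `p`, and this
entry has the largest norm in the leading block of indices at most `i`. -/
def IsReducedRow (p : ℕ) [Fact p.Prime] {ι : Type*} [LinearOrder ι]
    (b : Matrix ι ι ℚ_[p]) (i : ι) : Prop :=
  (∀ j < i, b i j = 0) ∧ (∃ r : ℤ, b i i = (p : ℚ_[p]) ^ r) ∧
    ∀ i' ≤ i, ∀ j' ≤ i, ‖b i' j'‖ ≤ ‖b i i‖

lemma exists_reduce_row (p : ℕ) [Fact p.Prime] {ι : Type*} [Fintype ι] [LinearOrder ι]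
    (b : Matrix ι ι ℚ_[p]) (hb : IsUnit b.det) (m : ι) (h : ∀ i, m < i → IsReducedRow p b i) :
    ∃ (σ : Equiv.Perm ι) (k : Matrix ι ι ℚ_[p]), IsGLZ p k ∧
      ∀ i, m ≤ i → IsReducedRow p (b.submatrix σ id * k) i := by
  obtain ⟨⟨a, c⟩, hac, hmax⟩ := Finset.exists_max_image
    ((Finset.univ.filter (· ≤ m)) ×ˢ (Finset.univ.filter (· ≤ m))) (fun x => ‖b x.1 x.2‖)
    ⟨(m, m), by simp⟩
  simp only [Finset.mem_product, Finset.mem_filter, Finset.mem_univ, true_and, Prod.forall,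
    and_imp] at hac hmax
  obtain ⟨ha, hc⟩ := hac
  have hne : b a c ≠ 0 := by
    intro h0
    apply hb.ne_zero
    apply Matrix.det_eq_zero_of_column_eq_zero m
    intro i
    rcases le_or_gt i m with hi | hi
    · have := hmax i m hi le_rfl
      simpa [h0] using this
    · exact (h i hi).1 m hi
  set B := b.submatrix (Equiv.swap a m) (Equiv.swap c m) with hB
  have hBmm : B m m = b a c := by simp [hB]
  have hBne : B m m ≠ 0 := hBmm ▸ hne
  have hBle : ∀ i ≤ m, ∀ j ≤ m, ‖B i j‖ ≤ ‖B m m‖ := fun i hi j hj => by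
    rw [hBmm]
    exact hmax _ _ (swap_apply_le ha le_rfl hi) (swap_apply_le hc le_rfl hj)
  set r : ℤ := (B m m).valuation with hr
  have hrn : ‖(p : ℚ_[p]) ^ r‖ = ‖B m m‖ := by
    rw [Padic.norm_p_zpow, Padic.norm_eq_zpow_neg_valuation hBne]
  set w : ι → ℚ_[p] := fun j => if j < m then - B m j / B m m else
    if j = m then (p : ℚ_[p]) ^ r / B m m - 1 else 0 with hw
  have hwm : w m = (p : ℚ_[p]) ^ r / B m m - 1 := by simp [hw]
  have hwn : ∀ j, ‖w j‖ ≤ 1 := by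
    intro j
    have hpos : 0 < ‖B m m‖ := norm_pos_iff.2 hBne
    simp only [hw]
    split_ifs with h1 h2
    · rw [norm_div, norm_neg, div_le_one hpos]
      exact hBle m le_rfl j h1.le
    · rw [sub_eq_add_neg]
      refine (IsUltrametricDist.norm_add_le_max _ _).trans ?_
      rw [norm_div, hrn, div_self hpos.ne']
      simp
    · simp
  set E : Matrix ι ι ℚ_[p] := 1 + vecMulVec (Pi.single m 1) w with hE
  have hEn : IsGLZ p E := by
    constructor
    · intro i j
      refine (IsUltrametricDist.norm_add_le_max _ _).trans (max_le ((isGLZ_one p).1 i j) ?_)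
      rw [vecMulVec_apply, norm_mul, Pi.single_apply]
      split_ifs
      · simpa using hwn j
      · simp
    · rw [hE, vecMulVec_eq Unit, det_one_add_replicateCol_mul_replicateRow, dotProduct_single,
        mul_one, hwm, add_sub_cancel, norm_div, hrn, div_self (norm_ne_zero_iff.2 hBne)]
  have hBE : ∀ i j, (B * E) i j = B i j + B i m * w j := by
    intro i j
    simp [hE, mul_add, Matrix.add_apply, mul_vecMulVec, vecMulVec_apply]
  have hbound : ∀ I, m ≤ I → ∀ C : ℝ, (∀ i ≤ I, ∀ j ≤ I, ‖B i j‖ ≤ C) →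
      ∀ i ≤ I, ∀ j ≤ I, ‖(B * E) i j‖ ≤ C := by
    intro I hI C hC i hi j hj
    rw [hBE]
    refine (IsUltrametricDist.norm_add_le_max _ _).trans (max_le (hC i hi j hj) ?_)
    rw [norm_mul]
    exact (mul_le_of_le_one_right (norm_nonneg _) (hwn j)).trans (hC i hi m hI)
  refine ⟨Equiv.swap a m, (1 : Matrix ι ι ℚ_[p]).submatrix (Equiv.refl ι) (Equiv.swap c m) * E,
    ((isGLZ_one p).submatrix _ _).mul hEn, ?_⟩
  have hprod : b.submatrix (Equiv.swap a m) id *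
      ((1 : Matrix ι ι ℚ_[p]).submatrix (Equiv.refl ι) (Equiv.swap c m) * E) = B * E := by
    rw [← Matrix.mul_assoc]
    congr 1
    ext i j
    simp [hB, Matrix.mul_apply, Matrix.one_apply]
  rw [hprod]
  intro i hi
  rcases hi.eq_or_lt with rfl | hi
  · have hd : (B * E) m m = (p : ℚ_[p]) ^ r := by
      rw [hBE, hwm]
      field_simp
      ring
    refine ⟨fun j hj => ?_, ⟨r, hd⟩, ?_⟩
    · rw [hBE]
      simp only [hw, if_pos hj]
      field_simp
      ring
    · rw [hd, hrn]
      exact hbound m le_rfl _ hBle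
  · obtain ⟨h1, ⟨s, hs⟩, h3⟩ := h i hi
    have hrow : ∀ j, (B * E) i j = b i (Equiv.swap c m j) := by
      intro j
      have hzero : B i m = 0 := by
        simp only [hB, submatrix_apply, swap_apply_of_gt ha hi]
        exact h1 _ (swap_apply_lt hc hi hi)
      rw [hBE, hzero, zero_mul, add_zero]
      simp [hB, swap_apply_of_gt ha hi]
    have hd : (B * E) i i = b i i := by rw [hrow, swap_apply_of_gt hc hi]
    refine ⟨fun j hj => ?_, ⟨s, hd.trans hs⟩, ?_⟩
    · rw [hrow]
      exact h1 _ (swap_apply_lt hc hi hj)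
    · rw [hd]
      exact hbound i hi.le _ fun i' hi' j' hj' =>
        h3 _ (swap_apply_le ha hi.le hi') _ (swap_apply_le hc hi.le hj')

lemma exists_reduced (p : ℕ) [Fact p.Prime] (n : ℕ) (y : Matrix (Fin n) (Fin n) ℚ_[p])
    (hy : IsUnit y.det) :
    ∃ (σ : Equiv.Perm (Fin n)) (k : Matrix (Fin n) (Fin n) ℚ_[p]), IsGLZ p k ∧
      ∀ i, IsReducedRow p (y.submatrix σ id * k) i := by
  suffices H : ∀ d : ℕ, ∃ (σ : Equiv.Perm (Fin n)) (k : Matrix (Fin n) (Fin n) ℚ_[p]),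
      IsGLZ p k ∧ ∀ i : Fin n, n ≤ i + d → IsReducedRow p (y.submatrix σ id * k) i by
    obtain ⟨σ, k, hk, h⟩ := H n
    exact ⟨σ, k, hk, fun i => h i (Nat.le_add_left _ _)⟩
  intro d
  induction d with
  | zero => exact ⟨1, 1, isGLZ_one p, fun i hi => absurd hi (by simp)⟩
  | succ d ih =>
    obtain ⟨σ, k, hk, h⟩ := ih
    rcases le_or_gt n d with hd | hd
    · exact ⟨σ, k, hk, fun i _ => h i (by omega)⟩
    have hu : IsUnit (y.submatrix σ id * k).det := by
      rw [det_mul, det_permute]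
      exact (((Equiv.Perm.sign σ).isUnit.map (Int.castRingHom ℚ_[p])).mul hy).mul hk.isUnit_det
    obtain ⟨τ, l, hl, h'⟩ := exists_reduce_row p _ hu ⟨n - d - 1, by omega⟩ fun i hi =>
      h i (by rw [Fin.lt_def] at hi; simp only at hi; omega)
    refine ⟨τ.trans σ, k * l, hk.mul hl, fun i hi => ?_⟩
    have := h' i (by rw [Fin.le_def]; simp only; omega)
    rwa [show (y.submatrix σ id * k).submatrix τ id = y.submatrix (τ.trans σ) id * k from rfl,
      Matrix.mul_assoc] at this

/-- refined Iwasawa/Cartan decomposition, via Cramer's rule: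
for every `y ∈ GL_n(ℚ_p)` there are a permutation matrix `w`, integers `r₁,…,r_n`,
an upper triangular unipotent `u`, and `k ∈ GL_n(ℤ_p)` such that, with
`t = diag(p^{r₁},…,p^{r_n})` and `b = t·u`, one has `w·y = t·u·k`, `t·u·t⁻¹ ∈ GL_n(ℤ_p)`,
the minimality property `v_p(b_{ii}) ≤ v_p(b_{i'j'})` for `i', j' ≤ i` (stated via norms),
and in particular `y ∈ GL_n(ℤ_p)·t·GL_n(ℤ_p)`. -/
theorem stmt0 (p : ℕ) [Fact p.Prime] (n : ℕ) (hn : 1 ≤ n)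
    (y : Matrix (Fin n) (Fin n) ℚ_[p]) (hy : IsUnit y.det) :
    ∃ (σ : Equiv.Perm (Fin n)) (r : Fin n → ℤ) (u k : Matrix (Fin n) (Fin n) ℚ_[p]),
      (∀ i j : Fin n, j < i → u i j = 0) ∧
      (∀ i : Fin n, u i i = 1) ∧
      IsUnit u.det ∧
      IsGLZ p k ∧
      permMat p σ * y = Matrix.diagonal (fun i => (p : ℚ_[p]) ^ r i) * u * k ∧
      IsGLZ p (Matrix.diagonal (fun i => (p : ℚ_[p]) ^ r i) * u *
        Matrix.diagonal (fun i => (p : ℚ_[p]) ^ (-r i))) ∧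
      (∀ i i' j' : Fin n, i' ≤ i → j' ≤ i →
        (Matrix.diagonal (fun i => (p : ℚ_[p]) ^ r i) * u) i' j' ≠ 0 →
        ‖(Matrix.diagonal (fun i => (p : ℚ_[p]) ^ r i) * u) i' j'‖ ≤
          ‖(Matrix.diagonal (fun i => (p : ℚ_[p]) ^ r i) * u) i i‖) ∧
      ∃ k₁ k₂ : Matrix (Fin n) (Fin n) ℚ_[p], IsGLZ p k₁ ∧ IsGLZ p k₂ ∧
        y = k₁ * Matrix.diagonal (fun i => (p : ℚ_[p]) ^ r i) * k₂ := by
  obtain ⟨σ, k, hk, h⟩ := exists_reduced p n y hy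
  choose h1 h2 h3 using h
  choose r hr using h2
  set b := y.submatrix σ id * k with hb
  have hp : (p : ℚ_[p]) ≠ 0 := by exact_mod_cast (Fact.out : p.Prime).ne_zero
  set t : Matrix (Fin n) (Fin n) ℚ_[p] := Matrix.diagonal (fun i => (p : ℚ_[p]) ^ r i) with ht
  set t' : Matrix (Fin n) (Fin n) ℚ_[p] := Matrix.diagonal (fun i => (p : ℚ_[p]) ^ (-r i)) with ht'
  have htt' : t * t' = 1 := by
    rw [ht, ht', diagonal_mul_diagonal, ← diagonal_one]
    congr 1
    funext i
    rw [← zpow_add₀ hp, add_neg_cancel, zpow_zero]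
  have ht't : t' * t = 1 := mul_eq_one_comm.1 htt'
  have htu : t * (t' * b) = b := by rw [← Matrix.mul_assoc, htt', Matrix.one_mul]
  have hu1 : ∀ i j : Fin n, j < i → (t' * b) i j = 0 := fun i j hij => by
    rw [ht', diagonal_mul, h1 i j hij, mul_zero]
  have hu2 : ∀ i : Fin n, (t' * b) i i = 1 := fun i => by
    rw [ht', diagonal_mul, hr, ← zpow_add₀ hp, neg_add_cancel, zpow_zero]
  have hdet : (t' * b).det = 1 := by
    rw [det_of_isUpperTriangular (fun i j hij => hu1 i j hij)]
    simp [hu2]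
  have hy' : y.submatrix σ id = b * k⁻¹ := by
    rw [hb, Matrix.mul_nonsing_inv_cancel_right _ _ hk.isUnit_det]
  have hconj : IsGLZ p (b * t') := by
    constructor
    · intro i j
      rcases lt_or_ge j i with hij | hij
      · simp [ht', mul_diagonal, h1 i j hij]
      · have : ‖(p : ℚ_[p]) ^ r j‖ ≠ 0 := norm_ne_zero_iff.2 (zpow_ne_zero _ hp)
        rw [ht', mul_diagonal, norm_mul, _root_.zpow_neg, norm_inv, ← div_eq_mul_inv,
          div_le_one (lt_of_le_of_ne (norm_nonneg _) this.symm), ← hr]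
        exact h3 j i hij j le_rfl
    · rw [det_mul, mul_comm, ← det_mul, hdet, norm_one]
  refine ⟨σ.symm, r, t' * b, k⁻¹, hu1, hu2, by rw [hdet]; exact isUnit_one, hk.inv, ?_, ?_, ?_,
    (b * t').submatrix σ.symm (Equiv.refl _), k⁻¹, hconj.submatrix _ _, hk.inv, ?_⟩
  · rw [permMat_mul, htu, Equiv.symm_symm, hy']
  · rwa [htu]
  · intro i i' j' hi hj _
    rw [htu]
    exact h3 i i' hi j' hj
  · have hperm : y = (y.submatrix σ id).submatrix σ.symm id := by
      ext i j
      simp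
    calc y = (b * k⁻¹).submatrix σ.symm id := by rw [← hy', ← hperm]
      _ = (b * t' * t * k⁻¹).submatrix σ.symm id := by
        rw [Matrix.mul_assoc b, ht't, Matrix.mul_one]
end

section
/- Let p be a prime and let n ≥ 2 and l ≥ 1 be integers. Let y ∈ GL_n(ℚ_p) and let u ∈ ℚ_p^n be a column vector; assume min_{i,j} v_p(y_{ij}) ≤ 0 and min_i v_p(u_i) ≤ 0, and set e := −min_{i,j} v_p(y_{ij}), e′ := −min_i v_p(u_i). Assume e < e′, and suppose there exists λ ∈ ℚ_p^× such that λ·[[y,u],[0,1]] ∈ GL_{n+1}(ℤ_p)·diag(1,…,1,p^{−l})·GL_{n+1}(ℤ_p). Then 2e′ − e = l and 0 ≤ e < e′ < l, and there exist a permutation matrix w, a column vector u″ ∈ ℚ_p^{n−1}, and k ∈ GL_n(ℤ_p) such that, writing w·u = (u′; α) with u′ ∈ ℚ_p^{n−1} and last coordinate α: every entry of u′ lies in p^{−e′}ℤ_p, α ∈ p^{−e′}ℤ_p^×, w·y = diag(p^{e′−e},…,p^{e′−e},p^{−e})·U(u″)·k (with n−1 diagonal entries p^{e′−e} = p^{(l−e)/2}),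 and u″ − p^{−e′}·α^{−1}·u′ ∈ ℤ_p^{n−1}. -/
open Matrix

/-- The block matrix `[[y, u], [0, 1]]`. -/
noncomputable def blockExt (p : ℕ) [Fact p.Prime] {ι : Type*} (y : Matrix ι ι ℚ_[p]) (u : ι → ℚ_[p]) :
    Matrix (ι ⊕ Unit) (ι ⊕ Unit) ℚ_[p] :=
  Matrix.fromBlocks y (Matrix.of (fun i _ => u i)) 0 1

/-- The unipotent matrix `U(u″)` with upper-left block `I`, last column `(u″;1)` and last
row `(0,…,0,1)`. -/
noncomputable def Umat (p : ℕ) [Fact p.Prime] {m : ℕ} (u'' : Fin m → ℚ_[p]) :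
    Matrix (Fin m ⊕ Unit) (Fin m ⊕ Unit) ℚ_[p] :=
  Matrix.of (fun i j =>
    match i, j with
    | Sum.inl a, Sum.inl b => if a = b then 1 else 0
    | Sum.inl a, Sum.inr _ => u'' a
    | Sum.inr _, Sum.inl _ => 0
    | Sum.inr _, Sum.inr _ => 1)

/-- `w·u`, the image of the vector `u` under the permutation matrix of `σ`. -/
noncomputable def wvec (p : ℕ) [Fact p.Prime] {ι : Type*} [Fintype ι] [DecidableEq ι]
    (σ : Equiv.Perm ι) (u : ι → ℚ_[p]) : ι → ℚ_[p] :=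
  (permMat p σ).mulVec u

theorem Padic.norm_det_le_prod {p : ℕ} [Fact p.Prime] {ι : Type*} [Fintype ι] [DecidableEq ι]
    (A : Matrix ι ι ℚ_[p]) (b : ι → ℝ) (h : ∀ i j, ‖A i j‖ ≤ b i) : ‖A.det‖ ≤ ∏ i, b i := by
  rw [← Matrix.det_transpose, Matrix.det_apply']
  refine IsUltrametricDist.norm_sum_le_of_forall_le_of_nonneg
    (Finset.prod_nonneg fun i _ => (norm_nonneg _).trans (h i i)) fun σ _ => ?_
  have hs : ‖((Equiv.Perm.sign σ : ℤ) : ℚ_[p])‖ = 1 := by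
    rcases Int.units_eq_one_or (Equiv.Perm.sign σ) with h | h <;> simp [h]
  rw [norm_mul, hs, one_mul, norm_prod]
  exact Finset.prod_le_prod (fun _ _ => norm_nonneg _) fun i _ => h i (σ i)

theorem IsGLZ.transpose {p : ℕ} [Fact p.Prime] {ι : Type*} [Fintype ι] [DecidableEq ι]
    {g : Matrix ι ι ℚ_[p]} (hg : IsGLZ p g) : IsGLZ p gᵀ :=
  ⟨fun i j => hg.1 j i, by rw [Matrix.det_transpose, hg.2]⟩

theorem IsGLZ.mul_norm_le {p : ℕ} [Fact p.Prime] {ι : Type*} [Fintype ι] [DecidableEq ι]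
    {g h : Matrix ι ι ℚ_[p]} (hg : IsGLZ p g) (hh : IsGLZ p h) (i j : ι) :
    ‖(g * h) i j‖ ≤ 1 := by
  rw [Matrix.mul_apply]
  refine IsUltrametricDist.norm_sum_le_of_forall_le_of_nonneg zero_le_one fun k _ => ?_
  rw [norm_mul]
  exact mul_le_one₀ (hg.1 i k) (norm_nonneg _) (hh.1 k j)

/-- Every row of an element of `GL(ℤ_p)` is primitive. -/
theorem IsGLZ.exists_norm_eq_one {p : ℕ} [Fact p.Prime] {ι : Type*} [Fintype ι] [DecidableEq ι]
    {g : Matrix ι ι ℚ_[p]} (hg : IsGLZ p g) (i : ι) : ∃ j, ‖g i j‖ = 1 := by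
  by_contra! hne
  have hp : (1 : ℝ) < p := by exact_mod_cast (Fact.out : p.Prime).one_lt
  have hlt : ∀ j, ‖g i j‖ ≤ (p : ℝ)⁻¹ := fun j => by
    have := (Padic.norm_le_pow_iff_norm_lt_pow_add_one (g i j) (-1)).2
      (by simpa using lt_of_le_of_ne (hg.1 i j) (hne j))
    simpa using this
  have hb := Padic.norm_det_le_prod g (Function.update (fun _ => (1 : ℝ)) i (p : ℝ)⁻¹) fun k j => by
    by_cases hk : k = i
    · subst hk; simpa using hlt j
    · simpa [hk] using hg.1 k j
  rw [hg.2, Finset.prod_update_of_mem (Finset.mem_univ i)] at hb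
  have := inv_lt_one_of_one_lt₀ hp
  simp at hb
  linarith

/-- A matrix that is integral up to a rank-one matrix of size at most `q` has `2 × 2` minors of
size at most `q`. -/
theorem Padic.norm_minor_le {p : ℕ} [Fact p.Prime] {ι κ : Type*} {M K : Matrix ι κ ℚ_[p]}
    {s : ℚ_[p]} {c : ι → ℚ_[p]} {r : κ → ℚ_[p]} (hM : ∀ i j, M i j = K i j + s * c i * r j)
    (hK : ∀ i j, ‖K i j‖ ≤ 1) (hc : ∀ i, ‖c i‖ ≤ 1) (hr : ∀ j, ‖r j‖ ≤ 1) (hs : 1 ≤ ‖s‖)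
    (i i' : ι) (j j' : κ) : ‖M i j * M i' j' - M i j' * M i' j‖ ≤ ‖s‖ := by
  have hmul : ∀ {a b : ℚ_[p]}, ‖a‖ ≤ 1 → ‖b‖ ≤ 1 → ‖a * b‖ ≤ 1 := fun ha hb => by
    rw [norm_mul]; exact mul_le_one₀ ha (norm_nonneg _) hb
  have hadd : ∀ {a b : ℚ_[p]} {q : ℝ}, ‖a‖ ≤ q → ‖b‖ ≤ q → ‖a + b‖ ≤ q := fun ha hb =>
    (IsUltrametricDist.norm_add_le_max _ _).trans (max_le ha hb)
  have hsub : ∀ {a b : ℚ_[p]}, ‖a‖ ≤ 1 → ‖b‖ ≤ 1 → ‖a - b‖ ≤ 1 := fun {a b} ha hb => by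
    rw [sub_eq_add_neg]; exact hadd ha (by rwa [norm_neg])
  have key : M i j * M i' j' - M i j' * M i' j =
      (K i j * K i' j' - K i j' * K i' j) +
        s * ((K i j * (c i' * r j') - K i j' * (c i' * r j)) +
          (c i * r j * K i' j' - c i * r j' * K i' j)) := by
    simp only [hM]; ring
  rw [key]
  refine hadd ((hsub (hmul (hK _ _) (hK _ _)) (hmul (hK _ _) (hK _ _))).trans hs) ?_
  rw [norm_mul]
  refine mul_le_of_le_one_right (norm_nonneg _) (hadd (hsub ?_ ?_) (hsub ?_ ?_))
  · exact hmul (hK _ _) (hmul (hc _) (hr _))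
  · exact hmul (hK _ _) (hmul (hc _) (hr _))
  · exact hmul (hmul (hc _) (hr _)) (hK _ _)
  · exact hmul (hmul (hc _) (hr _)) (hK _ _)

/-- The invariants of the double coset of `diag(1, …, 1, p^{-l})`: maximal entry, maximal
`2 × 2` minor and determinant. -/
theorem IsGLZ.doubleCoset_norms {p : ℕ} [Fact p.Prime] {ι : Type*} [Fintype ι] [DecidableEq ι]
    {k₁ k₂ : Matrix (ι ⊕ Unit) (ι ⊕ Unit) ℚ_[p]} (h₁ : IsGLZ p k₁) (h₂ : IsGLZ p k₂)
    {l : ℕ} (hl : 1 ≤ l) {M : Matrix (ι ⊕ Unit) (ι ⊕ Unit) ℚ_[p]}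
    (hM : M = k₁ * Matrix.diagonal (Sum.elim (fun _ : ι => (1 : ℚ_[p]))
          (fun _ : Unit => (p : ℚ_[p]) ^ (-(l : ℤ)))) * k₂) :
    (∀ i j, ‖M i j‖ ≤ (p : ℝ) ^ l) ∧ (∃ i j, ‖M i j‖ = (p : ℝ) ^ l) ∧
      (∀ i i' j j', ‖M i j * M i' j' - M i j' * M i' j‖ ≤ (p : ℝ) ^ l) ∧
      ‖M.det‖ = (p : ℝ) ^ l := by
  have hp : (1 : ℝ) < p := by exact_mod_cast (Fact.out : p.Prime).one_lt
  have hpl : (1 : ℝ) < (p : ℝ) ^ l := one_lt_pow₀ hp (by omega)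
  have hnp : ‖(p : ℚ_[p]) ^ (-(l : ℤ))‖ = (p : ℝ) ^ l := by
    rw [Padic.norm_p_zpow]; simp
  have hs : ‖(p : ℚ_[p]) ^ (-(l : ℤ)) - 1‖ = (p : ℝ) ^ l := by
    rw [sub_eq_add_neg, IsUltrametricDist.norm_add_eq_max_of_norm_ne_norm, hnp]
    · simp [hpl.le]
    · rw [hnp]; simpa using hpl.ne'
  have hK := h₁.mul_norm_le h₂
  have hrank : ∀ i j, M i j = (k₁ * k₂) i j +
      ((p : ℚ_[p]) ^ (-(l : ℤ)) - 1) * k₁ i (Sum.inr ()) * k₂ (Sum.inr ()) j := by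
    intro i j
    rw [hM, Matrix.mul_apply, Matrix.mul_apply]
    simp only [Matrix.mul_diagonal, Fintype.sum_sum_type, Sum.elim_inl, Sum.elim_inr, mul_one,
      Finset.univ_unique, Finset.sum_singleton, PUnit.default_eq_unit]
    ring
  refine ⟨fun i j => ?_, ?_, fun i i' j j' => ?_, ?_⟩
  · rw [hrank]
    refine (IsUltrametricDist.norm_add_le_max _ _).trans (max_le ((hK i j).trans hpl.le) ?_)
    rw [norm_mul, norm_mul, hs, mul_assoc]
    exact mul_le_of_le_one_right (by positivity)
      (mul_le_one₀ (h₁.1 _ _) (norm_nonneg _) (h₂.1 _ _))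
  · obtain ⟨i, hi⟩ := h₁.transpose.exists_norm_eq_one (Sum.inr ())
    obtain ⟨j, hj⟩ := h₂.exists_norm_eq_one (Sum.inr ())
    rw [Matrix.transpose_apply] at hi
    refine ⟨i, j, ?_⟩
    have hprod : ‖((p : ℚ_[p]) ^ (-(l : ℤ)) - 1) * k₁ i (Sum.inr ()) * k₂ (Sum.inr ()) j‖ =
        (p : ℝ) ^ l := by rw [norm_mul, norm_mul, hs, hi, hj, mul_one, mul_one]
    have hlt := (hK i j).trans_lt hpl
    rw [hrank, IsUltrametricDist.norm_add_eq_max_of_norm_ne_norm, hprod, max_eq_right hlt.le]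
    rw [hprod]; exact hlt.ne
  · rw [← hs]
    exact Padic.norm_minor_le hrank hK (fun i => h₁.1 _ _) (fun j => h₂.1 _ _)
      (by rw [hs]; exact hpl.le) i i' j j'
  · rw [hM, Matrix.det_mul, Matrix.det_mul, norm_mul, norm_mul, h₁.2, h₂.2, Matrix.det_diagonal,
      Fintype.prod_sum_type]
    simp

theorem permMat_mul_apply {p : ℕ} [Fact p.Prime] {ι κ : Type*} [Fintype ι] [DecidableEq ι]
    (σ : Equiv.Perm ι) (y : Matrix ι κ ℚ_[p]) (i : ι) (j : κ) :
    (permMat p σ * y) i j = y (σ.symm i) j := by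
  simp [permMat, Matrix.mul_apply, ← Equiv.symm_apply_eq]

theorem wvec_apply {p : ℕ} [Fact p.Prime] {ι : Type*} [Fintype ι] [DecidableEq ι]
    (σ : Equiv.Perm ι) (u : ι → ℚ_[p]) (i : ι) : wvec p σ u i = u (σ.symm i) := by
  simp [wvec, permMat, Matrix.mulVec, dotProduct, ← Equiv.symm_apply_eq]

theorem det_Umat {p : ℕ} [Fact p.Prime] {m : ℕ} (v : Fin m → ℚ_[p]) : (Umat p v).det = 1 := by
  have h : Umat p v = Matrix.fromBlocks 1 (Matrix.of fun i _ => v i) 0 1 := by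
    ext (i | i) (j | j) <;> simp [Umat, Matrix.one_apply]
  rw [h, Matrix.det_fromBlocks_zero₂₁]
  simp

/-- If the last entry of `v` dominates the bounds on `Y` and on the `2 × 2` minors of `(Y | v)`,
then `Y` has the Iwasawa decomposition `diag(a, …, a, b) * U(v') * k`, where `v'` is
determined by `v`. -/
theorem exists_iwasawa_of_norm_minor_le {p : ℕ} [Fact p.Prime] {m : ℕ}
    {Y : Matrix (Fin m ⊕ Unit) (Fin m ⊕ Unit) ℚ_[p]} {v' : Fin m → ℚ_[p]} {a b : ℚ_[p]}
    (ha : a ≠ 0) (hb : b ≠ 0) (hlast : ∀ j, ‖Y (Sum.inr ()) j‖ ≤ ‖b‖)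
    (hminor : ∀ i j, ‖Y (Sum.inl i) j - a * v' i * b⁻¹ * Y (Sum.inr ()) j‖ ≤ ‖a‖)
    (hdet : ‖Y.det‖ = ‖a‖ ^ m * ‖b‖) :
    ∃ k, IsGLZ p k ∧
      Y = Matrix.diagonal (Sum.elim (fun _ : Fin m => a) (fun _ : Unit => b)) * Umat p v' * k := by
  have ha' := norm_pos_iff.2 ha
  have hb' := norm_pos_iff.2 hb
  let k : Matrix (Fin m ⊕ Unit) (Fin m ⊕ Unit) ℚ_[p] := Matrix.of fun i j =>
    Sum.elim (fun i => a⁻¹ * (Y (Sum.inl i) j - a * v' i * b⁻¹ * Y (Sum.inr ()) j))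
      (fun _ => b⁻¹ * Y (Sum.inr ()) j) i
  have hY : Y = Matrix.diagonal (Sum.elim (fun _ : Fin m => a) (fun _ : Unit => b)) *
      Umat p v' * k := by
    ext (i | i) j
    · rw [Matrix.mul_assoc, Matrix.diagonal_mul, Matrix.mul_apply, Fintype.sum_sum_type]
      simp [Umat, k]
      field_simp
      ring
    · rw [Matrix.mul_assoc, Matrix.diagonal_mul, Matrix.mul_apply, Fintype.sum_sum_type]
      simp [Umat, k]
      field_simp
  refine ⟨k, ⟨?_, ?_⟩, hY⟩
  · rintro (i | i) j
    · simpa [k, inv_mul_le_iff₀ ha'] using hminor i j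
    · simpa [k, inv_mul_le_iff₀ hb'] using hlast j
  · have h := congrArg (fun A => ‖A.det‖) hY
    simp only [Matrix.det_mul, det_Umat, Matrix.det_diagonal, Fintype.prod_sum_type, norm_mul,
      Sum.elim_inl, Sum.elim_inr, Finset.prod_const, Finset.card_univ, Fintype.card_fin,
      Fintype.card_unit, norm_pow, hdet, mul_one, pow_one] at h
    exact mul_left_cancel₀ (by positivity : ‖a‖ ^ m * ‖b‖ ≠ 0) (by rw [← h, mul_one])

/-- case (B) of Lemma 6.1: support of the off-diagonal amplification
Hecke operator.  Here `n = m + 2` and the index set of size `n` is `Fin (m+1) ⊕ Unit`,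
the `Unit` being the last coordinate. -/
theorem stmt2 (p : ℕ) [Fact p.Prime] (m : ℕ) (l : ℕ) (hl : 1 ≤ l)
    (y : Matrix (Fin (m+1) ⊕ Unit) (Fin (m+1) ⊕ Unit) ℚ_[p]) (hy : IsUnit y.det)
    (u : (Fin (m+1) ⊕ Unit) → ℚ_[p]) (e e' : ℕ)
    (hey : ∀ i j, ‖y i j‖ ≤ (p : ℝ) ^ e) (hey' : ∃ i j, ‖y i j‖ = (p : ℝ) ^ e)
    (heu : ∀ i, ‖u i‖ ≤ (p : ℝ) ^ e') (heu' : ∃ i, ‖u i‖ = (p : ℝ) ^ e')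
    (hee : e < e')
    (hcoset : ∃ lam : ℚ_[p], lam ≠ 0 ∧ ∃ k₁ k₂, IsGLZ p k₁ ∧ IsGLZ p k₂ ∧
      lam • blockExt p y u =
        k₁ * Matrix.diagonal (Sum.elim (fun _ : Fin (m+1) ⊕ Unit => (1 : ℚ_[p]))
          (fun _ : Unit => (p : ℚ_[p]) ^ (-(l : ℤ)))) * k₂) :
    2 * (e' : ℤ) - (e : ℤ) = (l : ℤ) ∧ e' < l ∧
    ∃ (σ : Equiv.Perm (Fin (m+1) ⊕ Unit)) (u'' : Fin (m+1) → ℚ_[p])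
      (k : Matrix (Fin (m+1) ⊕ Unit) (Fin (m+1) ⊕ Unit) ℚ_[p]),
      (∀ i : Fin (m+1), ‖wvec p σ u (Sum.inl i)‖ ≤ (p : ℝ) ^ e') ∧
      ‖wvec p σ u (Sum.inr ())‖ = (p : ℝ) ^ e' ∧
      IsGLZ p k ∧
      permMat p σ * y =
        Matrix.diagonal (Sum.elim (fun _ : Fin (m+1) => (p : ℚ_[p]) ^ ((e' : ℤ) - (e : ℤ)))
          (fun _ : Unit => (p : ℚ_[p]) ^ (-(e : ℤ)))) * Umat p u'' * k ∧
      ∀ i : Fin (m+1),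
        ‖u'' i - (p : ℚ_[p]) ^ (-(e' : ℤ)) * (wvec p σ u (Sum.inr ()))⁻¹ *
          wvec p σ u (Sum.inl i)‖ ≤ 1 := by
  have hp : (1 : ℝ) < p := by exact_mod_cast (Fact.out : p.Prime).one_lt
  have hp0 : (0 : ℝ) < p := by linarith
  have hpe' : 0 < (p : ℝ) ^ e' := by positivity
  obtain ⟨lam, hlam, k₁, k₂, h₁, h₂, hM⟩ := hcoset
  obtain ⟨hle, ⟨i₁, j₁, hentry⟩, hminor, hdet⟩ := h₁.doubleCoset_norms h₂ hl hM
  obtain ⟨i₀, hi₀⟩ := heu'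
  obtain ⟨i₂, j₂, hi₂⟩ := hey'
  have hL : 0 < ‖lam‖ := norm_pos_iff.2 hlam
  have hu₀ : u i₀ ≠ 0 := norm_pos_iff.1 (hi₀ ▸ hpe')
  have hmax : ‖lam‖ * (p : ℝ) ^ e' = (p : ℝ) ^ l := by
    refine le_antisymm ?_ ?_
    · simpa [blockExt, hi₀] using hle (Sum.inl i₀) (Sum.inr ())
    · rw [← hentry, Matrix.smul_apply, smul_eq_mul, norm_mul]
      refine mul_le_mul_of_nonneg_left ?_ hL.le
      rcases i₁ with i | i <;> rcases j₁ with j | j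
      · exact (hey i j).trans (pow_le_pow_right₀ hp.le hee.le)
      · exact heu i
      · simp [blockExt]
      · simpa [blockExt] using one_le_pow₀ hp.le
  have hlow : ‖lam‖ ^ 2 * (p : ℝ) ^ e ≤ (p : ℝ) ^ l := by
    have h := hminor (Sum.inl i₂) (Sum.inr ()) (Sum.inl j₂) (Sum.inr ())
    simp only [Matrix.smul_apply, blockExt, Matrix.fromBlocks_apply₁₁, Matrix.fromBlocks_apply₁₂,
      Matrix.fromBlocks_apply₂₁, Matrix.fromBlocks_apply₂₂, smul_eq_mul, Matrix.zero_apply,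
      Matrix.one_apply_eq, mul_zero, sub_zero, mul_one, norm_mul, hi₂] at h
    linarith
  -- the rows of `y` other than `i₀`, cleared by means of `u`
  have hclear : ∀ i j, ‖lam‖ * ‖y i j - u i * (u i₀)⁻¹ * y i₀ j‖ ≤ 1 := by
    intro i j
    have h := hminor (Sum.inl i) (Sum.inl i₀) (Sum.inl j) (Sum.inr ())
    simp only [Matrix.smul_apply, blockExt, Matrix.fromBlocks_apply₁₁, Matrix.fromBlocks_apply₁₂,
      smul_eq_mul, Matrix.of_apply] at h
    have heq : lam * y i j * (lam * u i₀) - lam * u i * (lam * y i₀ j) =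
        lam * u i₀ * (lam * (y i j - u i * (u i₀)⁻¹ * y i₀ j)) := by
      field_simp
    rw [heq, norm_mul, norm_mul, hi₀, hmax, norm_mul] at h
    exact (mul_le_iff_le_one_right (by positivity)).1 h
  have hdety : ‖lam‖ ^ (m + 3) * ‖y.det‖ = (p : ℝ) ^ l := by
    rw [← hdet, Matrix.det_smul, blockExt, Matrix.det_fromBlocks_zero₂₁]
    simp [add_assoc]
  have hupp : (p : ℝ) ^ l ≤ ‖lam‖ ^ 2 * (p : ℝ) ^ e := by
    let B : Matrix (Fin (m+1) ⊕ Unit) (Fin (m+1) ⊕ Unit) ℚ_[p] := Matrix.of fun i j =>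
      if i = i₀ then lam * y i₀ j else lam * (y i j - u i * (u i₀)⁻¹ * y i₀ j)
    have hB : (lam • y).det = B.det := by
      refine Matrix.det_eq_of_forall_row_eq_smul_add_const
        (fun i => if i = i₀ then 0 else u i * (u i₀)⁻¹) i₀ (by simp) fun i j => ?_
      by_cases hi : i = i₀
      · simp [B, hi]
      · simp [B, hi]; ring
    have hb := Padic.norm_det_le_prod B
      (Function.update (fun _ => (1 : ℝ)) i₀ (‖lam‖ * (p : ℝ) ^ e)) fun i j => by
        by_cases hi : i = i₀
        · subst hi
          simpa [B] using mul_le_mul_of_nonneg_left (hey i j) hL.le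
        · simpa [B, hi] using hclear i j
    rw [← hB, Finset.prod_update_of_mem (Finset.mem_univ i₀), Matrix.det_smul, norm_mul,
      norm_pow] at hb
    simp only [Fintype.card_sum, Fintype.card_fin, Fintype.card_unit, Finset.prod_const_one,
      mul_one] at hb
    calc (p : ℝ) ^ l = ‖lam‖ * (‖lam‖ ^ (m + 1 + 1) * ‖y.det‖) := by rw [← hdety]; ring
      _ ≤ ‖lam‖ * (‖lam‖ * (p : ℝ) ^ e) := mul_le_mul_of_nonneg_left hb hL.le
      _ = _ := by ring
  have hsq := le_antisymm hlow hupp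
  have hlame : ‖lam‖ * (p : ℝ) ^ e = (p : ℝ) ^ e' :=
    mul_left_cancel₀ hL.ne' (by rw [hmax, ← hsq]; ring)
  have hexp : 2 * e' = l + e := by
    refine pow_right_injective₀ hp0 hp.ne' ?_
    show (p : ℝ) ^ (2 * e') = (p : ℝ) ^ (l + e)
    rw [pow_add, ← hmax, two_mul, pow_add]
    nth_rewrite 1 [← hlame]
    ring
  refine ⟨by omega, by omega, Equiv.swap i₀ (Sum.inr ()), ?_⟩
  set σ := Equiv.swap i₀ (Sum.inr ()) with hσ
  have hσ₀ : σ.symm (Sum.inr ()) = i₀ := by simp [hσ]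
  have hpQ : (p : ℚ_[p]) ≠ 0 := by exact_mod_cast (Fact.out : p.Prime).ne_zero
  have hna : ‖(p : ℚ_[p]) ^ ((e' : ℤ) - e)‖ = ‖lam‖⁻¹ := by
    rw [Padic.norm_p_zpow, _root_.zpow_neg, zpow_sub₀ hp0.ne', zpow_natCast, zpow_natCast, ← hlame,
      mul_div_cancel_right₀ _ (by positivity)]
  have hnb : ‖(p : ℚ_[p]) ^ (-(e : ℤ))‖ = (p : ℝ) ^ e := by
    rw [Padic.norm_p_zpow]; simp
  obtain ⟨k, hk, hY⟩ := exists_iwasawa_of_norm_minor_le (Y := permMat p σ * y)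
    (v' := fun i => (p : ℚ_[p]) ^ (-(e' : ℤ)) * (wvec p σ u (Sum.inr ()))⁻¹ *
      wvec p σ u (Sum.inl i))
    (zpow_ne_zero ((e' : ℤ) - e) hpQ) (zpow_ne_zero (-(e : ℤ)) hpQ)
    (fun j => by rw [permMat_mul_apply, hnb]; exact hey _ _)
    (fun i j => by
      have hpow : (p : ℚ_[p]) ^ ((e' : ℤ) - e) * (p : ℚ_[p]) ^ (-(e' : ℤ)) *
          ((p : ℚ_[p]) ^ (-(e : ℤ)))⁻¹ = 1 := by
        rw [← _root_.zpow_neg, ← zpow_add₀ hpQ, ← zpow_add₀ hpQ,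
          show (e' : ℤ) - e + -e' + -(-(e : ℤ)) = 0 by ring, zpow_zero]
      have heq : (p : ℚ_[p]) ^ ((e' : ℤ) - e) * ((p : ℚ_[p]) ^ (-(e' : ℤ)) * (u i₀)⁻¹ *
          u (σ.symm (Sum.inl i))) * ((p : ℚ_[p]) ^ (-(e : ℤ)))⁻¹ =
          u (σ.symm (Sum.inl i)) * (u i₀)⁻¹ := by
        linear_combination (u (σ.symm (Sum.inl i)) * (u i₀)⁻¹) * hpow
      rw [permMat_mul_apply, permMat_mul_apply, wvec_apply, wvec_apply, hσ₀, heq, hna,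
        ← mul_one ‖lam‖⁻¹, le_inv_mul_iff₀ hL]
      exact hclear _ _)
    (by
      have hsub : permMat p σ * y = y.submatrix σ.symm id := by
        ext i j; exact permMat_mul_apply σ y i j
      have hsign : ‖((Equiv.Perm.sign σ.symm : ℤ) : ℚ_[p])‖ = 1 := by
        rcases Int.units_eq_one_or (Equiv.Perm.sign σ.symm) with h | h <;> simp [h]
      rw [hsub, Matrix.det_permute, norm_mul, hsign, one_mul, hna, hnb, inv_pow,
        eq_inv_mul_iff_mul_eq₀ (by positivity)]
      refine mul_left_cancel₀ (pow_ne_zero 2 hL.ne') ?_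
      rw [hsq, ← hdety]; ring)
  refine ⟨_, k, fun i => ?_, ?_, hk, hY, fun i => ?_⟩
  · rw [wvec_apply]; exact heu _
  · rw [wvec_apply, hσ₀, hi₀]
  · simp
end

section
/- Let p be a prime, n ≥ 2 an integer, r ≥ 0 an integer, t ∈ ℚ_p with t ≠ 1, and ξ ∈ ℚ_p^{n−1} a column vector. Then there exists k ∈ GL_{n+1}(ℤ_p) such that ι(p^r·I_n)^{−1}·X(ξ,t)·ι(p^r·I_n) = (1−t)·k·M_A(ξ,t,r). (Indeed one may take k = I_{n+1} + p^r·E_{n+1,n}, where E_{n+1,n} has a single entry 1 in position (n+1,n) and zeros elsewhere.) -/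
open Matrix

/-- The matrix `X(ξ,t) ∈ GL_{n+1}(ℚ_p)` (here `n = m+2`, and the index set of size `n+1`
is `(Fin (m+1) ⊕ Unit) ⊕ Unit`, with `Fin (m+1)` the first `n-1` coordinates, the inner
`Unit` the `n`-th coordinate and the outer `Unit` the `(n+1)`-st coordinate): the
upper-left `(n-1)×(n-1)` block is the identity, the last column is
`((1-t)ξ₁,…,(1-t)ξ_{n-1}, t, 1)ᵀ`, the entries in positions `(n,n)` and `(n+1,n)` equal
`1`, and all remaining entries are `0`. -/
noncomputable def Xmat (p : ℕ) [Fact p.Prime] {m : ℕ} (ξ : Fin (m+1) → ℚ_[p]) (t : ℚ_[p]) :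
    Matrix ((Fin (m+1) ⊕ Unit) ⊕ Unit) ((Fin (m+1) ⊕ Unit) ⊕ Unit) ℚ_[p] :=
  Matrix.of (fun i j =>
    match i, j with
    | Sum.inl (Sum.inl a), Sum.inl (Sum.inl b) => if a = b then 1 else 0
    | Sum.inl (Sum.inl a), Sum.inr _ => (1 - t) * ξ a
    | Sum.inl (Sum.inr _), Sum.inl (Sum.inr _) => 1
    | Sum.inl (Sum.inr _), Sum.inr _ => t
    | Sum.inr _, Sum.inl (Sum.inr _) => 1
    | Sum.inr _, Sum.inr _ => 1
    | _, _ => 0)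

/-- `ι(z·I_n) ∈ GL_{n+1}(ℚ_p)`, the block-diagonal matrix `diag(z,…,z,1)`. -/
noncomputable def iotaScalar (p : ℕ) [Fact p.Prime] {ι : Type*} [DecidableEq ι] (z : ℚ_[p]) :
    Matrix (ι ⊕ Unit) (ι ⊕ Unit) ℚ_[p] :=
  Matrix.diagonal (Sum.elim (fun _ : ι => z) (fun _ : Unit => 1))

/-- The block-diagonal embedding `ι(y) = diag(y, 1)`. -/
noncomputable def iotaMat (p : ℕ) [Fact p.Prime] {ι : Type*} (y : Matrix ι ι ℚ_[p]) :
    Matrix (ι ⊕ Unit) (ι ⊕ Unit) ℚ_[p] :=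
  Matrix.fromBlocks y 0 0 1

/-- The matrix `M_A(ξ,t,r)`: upper-left `n×n` block `(1-t)⁻¹·I_n`, last column
`(p^{-r}ξ₁,…,p^{-r}ξ_{n-1}, p^{-r}t(1-t)⁻¹, 1)ᵀ`, last row `(0,…,0,1)`. -/
noncomputable def MAmat (p : ℕ) [Fact p.Prime] {m : ℕ} (ξ : Fin (m+1) → ℚ_[p]) (t : ℚ_[p]) (r : ℤ) :
    Matrix ((Fin (m+1) ⊕ Unit) ⊕ Unit) ((Fin (m+1) ⊕ Unit) ⊕ Unit) ℚ_[p] :=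
  Matrix.of (fun i j =>
    match i, j with
    | Sum.inl a, Sum.inl b => if a = b then (1 - t)⁻¹ else 0
    | Sum.inl (Sum.inl a), Sum.inr _ => (p : ℚ_[p]) ^ (-r) * ξ a
    | Sum.inl (Sum.inr _), Sum.inr _ => (p : ℚ_[p]) ^ (-r) * t * (1 - t)⁻¹
    | Sum.inr _, Sum.inl _ => 0
    | Sum.inr _, Sum.inr _ => 1)

/-- A transvection with an integral off-diagonal entry lies in `GL(ℤ_p)`. -/
lemma isGLZ_transvection {p : ℕ} [Fact p.Prime] {ι : Type*} [Fintype ι] [DecidableEq ι]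
    {i j : ι} (hij : i ≠ j) {c : ℚ_[p]} (hc : ‖c‖ ≤ 1) :
    IsGLZ p (Matrix.transvection i j c) := by
  refine ⟨fun a b => ?_, by rw [Matrix.det_transvection_of_ne i j hij, norm_one]⟩
  rw [Matrix.transvection, Matrix.add_apply]
  refine (Padic.nonarchimedean _ _).trans (max_le ?_ ?_)
  · rw [Matrix.one_apply]
    split_ifs <;> simp
  · rw [Matrix.single_apply]
    split_ifs <;> simp [hc]

/-- Cramer's-rule factorization, case (A) with `r ≥ 0`, from the proof of
Lemma 9.4: `ι(p^r·I_n)⁻¹·X(ξ,t)·ι(p^r·I_n) = (1-t)·k·M_A(ξ,t,r)` for some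
`k ∈ GL_{n+1}(ℤ_p)`. -/
theorem stmt5 (p : ℕ) [Fact p.Prime] (m : ℕ) (r : ℤ) (hr : 0 ≤ r)
    (t : ℚ_[p]) (ht : t ≠ 1) (ξ : Fin (m+1) → ℚ_[p]) :
    ∃ k : Matrix ((Fin (m+1) ⊕ Unit) ⊕ Unit) ((Fin (m+1) ⊕ Unit) ⊕ Unit) ℚ_[p],
      IsGLZ p k ∧
      iotaScalar p ((p : ℚ_[p]) ^ (-r)) * Xmat p ξ t * iotaScalar p ((p : ℚ_[p]) ^ r) =
        (1 - t) • (k * MAmat p ξ t r) := by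
  have hp : (p : ℚ_[p]) ≠ 0 := by exact_mod_cast (Fact.out : p.Prime).ne_zero
  have h1t : (1 - t) ≠ 0 := sub_ne_zero.mpr ht.symm
  refine ⟨Matrix.transvection (Sum.inr ()) (Sum.inl (Sum.inr ())) ((p : ℚ_[p]) ^ r), ?_, ?_⟩
  · exact isGLZ_transvection (by simp) (by
      rw [Padic.norm_p_zpow]
      exact zpow_le_one_of_nonpos₀ (by exact_mod_cast (Fact.out : p.Prime).one_le) (by omega))
  · ext i j
    rw [iotaScalar, iotaScalar, Matrix.mul_diagonal, Matrix.diagonal_mul, Matrix.smul_apply,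
      smul_eq_mul]
    rcases i with i | ⟨⟩
    · rw [Matrix.transvection_mul_apply_of_ne _ _ _ _ (by simp)]
      rcases i with a | ⟨⟩ <;> rcases j with (b | ⟨⟩) | ⟨⟩ <;>
        simp [Xmat, MAmat, _root_.zpow_neg] <;> try split_ifs
      all_goals field_simp
    · rw [Matrix.transvection_mul_apply_same]
      rcases j with (b | ⟨⟩) | ⟨⟩ <;> simp [Xmat, MAmat, _root_.zpow_neg] <;> field_simp
      ring
end

section
/- Let p be a prime, n ≥ 2 an integer, r < 0 an integer, t ∈ ℚ_p with t ≠ 1, and ξ ∈ ℚ_p^{n−1} a column vector. Then there exists k ∈ GL_{n+1}(ℤ_p) such that ι(p^r·I_n)^{−1}·X(ξ,t)·ι(p^r·I_n) = p^{−r}·(1−t)·k·M_B(ξ,t,r). (Indeed one may take k to be the matrix agreeing with I_{n+1} in the upper-left (n−1)×(n−1) block, with lower-right 2×2 block having rows (p^{−r}, −1) and (1, 0), and zeros elsewhere.) -/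
open Matrix

/-- The matrix `M_B(ξ,t,r)`: upper-left `n×n` block
`diag(p^r(1-t)⁻¹,…,p^r(1-t)⁻¹, p^{2r}(1-t)⁻¹)`, last column
`(ξ₁,…,ξ_{n-1}, p^r(1-t)⁻¹, 1)ᵀ`, last row `(0,…,0,1)`. -/
noncomputable def MBmat (p : ℕ) [Fact p.Prime] {m : ℕ} (ξ : Fin (m+1) → ℚ_[p]) (t : ℚ_[p]) (r : ℤ) :
    Matrix ((Fin (m+1) ⊕ Unit) ⊕ Unit) ((Fin (m+1) ⊕ Unit) ⊕ Unit) ℚ_[p] :=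
  Matrix.of (fun i j =>
    match i, j with
    | Sum.inl (Sum.inl a), Sum.inl (Sum.inl b) =>
        if a = b then (p : ℚ_[p]) ^ r * (1 - t)⁻¹ else 0
    | Sum.inl (Sum.inr _), Sum.inl (Sum.inr _) => (p : ℚ_[p]) ^ (2 * r) * (1 - t)⁻¹
    | Sum.inl (Sum.inl a), Sum.inr _ => ξ a
    | Sum.inl (Sum.inr _), Sum.inr _ => (p : ℚ_[p]) ^ r * (1 - t)⁻¹
    | Sum.inr _, Sum.inr _ => 1
    | _, _ => 0)

/-- The block matrix `diag(1, [c, -1; 1, 0])`, with the index set grouped as in `Xmat`. -/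
def cornerMat {R ι : Type*} [CommRing R] [DecidableEq ι] (c : R) :
    Matrix ((ι ⊕ Unit) ⊕ Unit) ((ι ⊕ Unit) ⊕ Unit) R :=
  fromBlocks (fromBlocks 1 0 0 (of fun _ _ => c)) (of (Sum.elim 0 fun _ _ => -1))
    (of fun _ => Sum.elim 0 fun _ => 1) 0

theorem det_cornerMat {R ι : Type*} [CommRing R] [Fintype ι] [DecidableEq ι] (c : R) :
    (cornerMat (ι := ι) c).det = 1 := by
  let e : Unit ⊕ Unit ≃ Fin 2 :=
    (Equiv.sumCongr finOneEquiv.symm finOneEquiv.symm).trans finSumFinEquiv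
  have h : cornerMat (ι := ι) c =
      (fromBlocks (1 : Matrix ι ι R) 0 0 !![c, -1; 1, 0]).submatrix
        ((Equiv.sumAssoc ι Unit Unit).trans (Equiv.sumCongr (Equiv.refl ι) e))
        ((Equiv.sumAssoc ι Unit Unit).trans (Equiv.sumCongr (Equiv.refl ι) e)) := by
    ext ((i | i) | i) ((j | j) | j) <;> simp [cornerMat, e] <;> rfl
  rw [h, det_submatrix_equiv_self, det_fromBlocks_zero₂₁, det_fin_two]
  simp

theorem isGLZ_cornerMat (p : ℕ) [Fact p.Prime] {ι : Type*} [Fintype ι] [DecidableEq ι]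
    {c : ℚ_[p]} (hc : ‖c‖ ≤ 1) : IsGLZ p (cornerMat (ι := ι) c) := by
  refine ⟨?_, by rw [det_cornerMat, norm_one]⟩
  rintro ((i | i) | i) ((j | j) | j) <;> simp [cornerMat, hc, one_apply]
  split_ifs <;> simp

/-- Cramer's-rule factorization, case (B) with `r < 0`, from the proof of
Lemma 9.4: `ι(p^r·I_n)⁻¹·X(ξ,t)·ι(p^r·I_n) = p^{-r}·(1-t)·k·M_B(ξ,t,r)` for some
`k ∈ GL_{n+1}(ℤ_p)`. -/
theorem stmt6 (p : ℕ) [Fact p.Prime] (m : ℕ) (r : ℤ) (hr : r < 0)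
    (t : ℚ_[p]) (ht : t ≠ 1) (ξ : Fin (m+1) → ℚ_[p]) :
    ∃ k : Matrix ((Fin (m+1) ⊕ Unit) ⊕ Unit) ((Fin (m+1) ⊕ Unit) ⊕ Unit) ℚ_[p],
      IsGLZ p k ∧
      iotaScalar p ((p : ℚ_[p]) ^ (-r)) * Xmat p ξ t * iotaScalar p ((p : ℚ_[p]) ^ r) =
        ((p : ℚ_[p]) ^ (-r) * (1 - t)) • (k * MBmat p ξ t r) := by
  have hp : (p : ℚ_[p]) ≠ 0 := by exact_mod_cast (Fact.out : p.Prime).ne_zero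
  have ht' : 1 - t ≠ 0 := sub_ne_zero.mpr ht.symm
  have hc : ‖(p : ℚ_[p]) ^ (-r)‖ ≤ 1 := by
    rw [Padic.norm_p_zpow, neg_neg]
    exact zpow_le_one_of_nonpos₀ (by exact_mod_cast (Fact.out : p.Prime).one_le) hr.le
  refine ⟨cornerMat ((p : ℚ_[p]) ^ (-r)), isGLZ_cornerMat p hc, ?_⟩
  have hq : (p : ℚ_[p]) ^ r ≠ 0 := zpow_ne_zero _ hp
  ext ((i | i) | i) ((j | j) | j) <;>
    simp [iotaScalar, Xmat, MBmat, cornerMat, mul_apply, diagonal_apply, one_apply,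
      two_mul, zpow_add₀ hp] <;>
    grind
end

section
/- Let p be a prime, n ≥ 2 an integer, r ∈ ℤ, t ∈ ℚ_p with t ≠ 1, ξ ∈ ℚ_p^{n−1} a column vector, λ ∈ ℚ_p^×, and y ∈ GL_n(ℚ_p). If λ·M_A(ξ,t,r)·ι(y) ∈ GL_{n+1}(ℤ_p), then λ ∈ ℤ_p^×, v_p(t) − v_p(t−1) ≥ r, and v_p(ξ_j) ≥ r for every 1 ≤ j ≤ n−1. -/
open Matrix

/-- The determinant of a matrix with `p`-adic integer entries is a `p`-adic integer. -/
theorem norm_det_le_one_of_entries {p : ℕ} [Fact p.Prime] {ι : Type*} [Fintype ι] [DecidableEq ι]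
    (A : Matrix ι ι ℚ_[p]) (hA : ∀ i j, ‖A i j‖ ≤ 1) : ‖A.det‖ ≤ 1 := by
  let B : Matrix ι ι ℤ_[p] := Matrix.of fun i j => ⟨A i j, hA i j⟩
  have hB : ((B.det : ℤ_[p]) : ℚ_[p]) = A.det := RingHom.map_det PadicInt.Coe.ringHom B
  exact hB ▸ B.det.2

/-- The last column of `M_A(ξ,t,r)`, without its bottom entry. -/
noncomputable def MAcol (p : ℕ) [Fact p.Prime] {m : ℕ} (ξ : Fin (m+1) → ℚ_[p]) (t : ℚ_[p])
    (r : ℤ) : Matrix (Fin (m+1) ⊕ Unit) Unit ℚ_[p] :=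
  Matrix.of fun i _ =>
    Sum.elim (fun a => (p : ℚ_[p]) ^ (-r) * ξ a) (fun _ => (p : ℚ_[p]) ^ (-r) * t * (1 - t)⁻¹) i

theorem MAmat_eq_fromBlocks (p : ℕ) [Fact p.Prime] {m : ℕ} (ξ : Fin (m+1) → ℚ_[p]) (t : ℚ_[p])
    (r : ℤ) : MAmat p ξ t r = Matrix.fromBlocks ((1 - t)⁻¹ • 1) (MAcol p ξ t r) 0 1 := by
  ext i j
  rcases i with (i | i) | i <;> rcases j with (j | j) | j <;>
    simp [MAmat, MAcol, Matrix.one_apply]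

theorem smul_MAmat_mul_iotaMat (p : ℕ) [Fact p.Prime] {m : ℕ} (ξ : Fin (m+1) → ℚ_[p])
    (t : ℚ_[p]) (r : ℤ) (lam : ℚ_[p]) (y : Matrix (Fin (m+1) ⊕ Unit) (Fin (m+1) ⊕ Unit) ℚ_[p]) :
    lam • (MAmat p ξ t r * iotaMat p y) =
      Matrix.fromBlocks (lam • (1 - t)⁻¹ • y) (lam • MAcol p ξ t r) 0 (lam • 1) := by
  simp [MAmat_eq_fromBlocks, iotaMat, Matrix.fromBlocks_multiply, Matrix.fromBlocks_smul]

/-- forced integrality, case (A) of the proof of Lemma 9.4: if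
`λ·M_A(ξ,t,r)·ι(y) ∈ GL_{n+1}(ℤ_p)` then `λ ∈ ℤ_p^×`, `v_p(t) - v_p(t-1) ≥ r`
(stated as `‖t‖ ≤ p^{-r}·‖t-1‖`), and `v_p(ξ_j) ≥ r` (stated as `‖ξ_j‖ ≤ p^{-r}`). -/
theorem stmt7 (p : ℕ) [Fact p.Prime] (m : ℕ) (r : ℤ) (t : ℚ_[p]) (ht : t ≠ 1)
    (ξ : Fin (m+1) → ℚ_[p]) (lam : ℚ_[p]) (hlam : lam ≠ 0)
    (y : Matrix (Fin (m+1) ⊕ Unit) (Fin (m+1) ⊕ Unit) ℚ_[p]) (hy : IsUnit y.det)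
    (h : IsGLZ p (lam • (MAmat p ξ t r * iotaMat p y))) :
    ‖lam‖ = 1 ∧ ‖t‖ ≤ (p : ℝ) ^ (-r) * ‖t - 1‖ ∧ ∀ j, ‖ξ j‖ ≤ (p : ℝ) ^ (-r) := by
  rw [smul_MAmat_mul_iotaMat] at h
  obtain ⟨hentry, hdet⟩ := h
  have hlam_le : ‖lam‖ ≤ 1 := by simpa using hentry (Sum.inr ()) (Sum.inr ())
  have hblock : ‖(lam • (1 - t)⁻¹ • y).det‖ ≤ 1 :=
    norm_det_le_one_of_entries _ fun i j => hentry (Sum.inl i) (Sum.inl j)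
  have hlam_norm : ‖lam‖ = 1 := by
    rw [Matrix.det_fromBlocks_zero₂₁, norm_mul] at hdet
    have hl : ‖(lam • (1 : Matrix Unit Unit ℚ_[p])).det‖ = ‖lam‖ := by simp
    rw [hl] at hdet
    nlinarith [norm_nonneg lam]
  have hp : (0 : ℝ) < p := by exact_mod_cast (Fact.out : p.Prime).pos
  have hcol : ∀ x : ℚ_[p], ‖lam * ((p : ℚ_[p]) ^ (-r) * x)‖ ≤ 1 → ‖x‖ ≤ (p : ℝ) ^ (-r) := by
    intro x hx
    rw [norm_mul, norm_mul, hlam_norm, one_mul, Padic.norm_p_zpow, neg_neg] at hx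
    rwa [_root_.zpow_neg, ← one_div, le_div_iff₀' (zpow_pos hp r)]
  refine ⟨hlam_norm, ?_, fun j => hcol _ (hentry (Sum.inl (Sum.inl j)) (Sum.inr ()))⟩
  have hlast : ‖lam * ((p : ℚ_[p]) ^ (-r) * (t * (1 - t)⁻¹))‖ ≤ 1 := by
    rw [← mul_assoc _ t]
    exact hentry (Sum.inl (Sum.inr ())) (Sum.inr ())
  have hquot := hcol _ hlast
  rwa [norm_mul, norm_inv, norm_sub_rev, ← div_eq_mul_inv,
    div_le_iff₀ (norm_pos_iff.mpr (sub_ne_zero.mpr ht))] at hquot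
end

section
/- Let p be a prime, n ≥ 2 an integer, t ∈ ℚ_p with t ≠ 1, and ξ ∈ ℚ_p^{n−1} a column vector. Suppose there exist λ, z ∈ ℚ_p^×, k ∈ GL_n(ℤ_p) and y ∈ GL_n(ℚ_p) such that λ·ι(z·I_n)^{−1}·X(ξ,t)·ι(z·I_n)·ι(k·y) ∈ GL_{n+1}(ℤ_p). Then v_p(t) ≥ v_p(t−1) and ξ ∈ ℤ_p^{n−1}; equivalently, t/(t−1) ∈ ℤ_p and v_p(ξ_j) ≥ 0 for every 1 ≤ j ≤ n−1. -/
open Matrix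

/-- A row vector over `ℚ_p` that a matrix in `GL(ℤ_p)` carries to a standard basis vector
is `p`-integral. -/
theorem IsGLZ.norm_le_one_of_vecMul_eq_single {p : ℕ} [Fact p.Prime] {ι : Type*} [Fintype ι]
    [DecidableEq ι] {g : Matrix ι ι ℚ_[p]} (hg : IsGLZ p g) {r : ι → ℚ_[p]} {i : ι}
    (hr : r ᵥ* g = Pi.single i 1) (j : ι) : ‖r j‖ ≤ 1 := by
  let g₀ : Matrix ι ι ℤ_[p] := Matrix.of fun a b => ⟨g a b, hg.1 a b⟩
  have hmap : PadicInt.Coe.ringHom.mapMatrix g₀ = g := rfl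
  have hdet : IsUnit g₀.det := by
    rw [PadicInt.isUnit_iff, ← hg.2, ← hmap, ← RingHom.map_det]
    rfl
  have hinv : g * PadicInt.Coe.ringHom.mapMatrix g₀⁻¹ = 1 := by
    rw [← hmap, ← map_mul, Matrix.mul_nonsing_inv _ hdet, map_one]
  have hrow : r = Pi.single i 1 ᵥ* PadicInt.Coe.ringHom.mapMatrix g₀⁻¹ := by
    rw [← hr, Matrix.vecMul_vecMul, hinv, Matrix.vecMul_one]
  rw [hrow, Matrix.single_one_vecMul]
  exact (g₀⁻¹ i j).2

/-- unramified-place case (1) of Lemma 9.4: if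
`λ·ι(z·I_n)⁻¹·X(ξ,t)·ι(z·I_n)·ι(k·y) ∈ GL_{n+1}(ℤ_p)` then `v_p(t) ≥ v_p(t-1)`
(stated as `‖t‖ ≤ ‖t-1‖`, equivalently `t/(t-1) ∈ ℤ_p`) and `ξ ∈ ℤ_p^{n-1}`. -/
theorem stmt9 (p : ℕ) [Fact p.Prime] (m : ℕ) (t : ℚ_[p]) (ht : t ≠ 1)
    (ξ : Fin (m+1) → ℚ_[p]) (lam z : ℚ_[p]) (hlam : lam ≠ 0) (hz : z ≠ 0)
    (k : Matrix (Fin (m+1) ⊕ Unit) (Fin (m+1) ⊕ Unit) ℚ_[p]) (hk : IsGLZ p k)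
    (y : Matrix (Fin (m+1) ⊕ Unit) (Fin (m+1) ⊕ Unit) ℚ_[p]) (hy : IsUnit y.det)
    (h : IsGLZ p
      (lam • (iotaScalar p z⁻¹ * Xmat p ξ t * iotaScalar p z * iotaMat p (k * y)))) :
    ‖t‖ ≤ ‖t - 1‖ ∧ ∀ j, ‖ξ j‖ ≤ 1 := by
  have hs : 1 - t ≠ 0 := sub_ne_zero.mpr ht.symm
  set w := k * y
  set G := lam • (iotaScalar p z⁻¹ * Xmat p ξ t * iotaScalar p z * iotaMat p w) with hG
  let r : (Fin (m+1) ⊕ Unit) ⊕ Unit → ℚ_[p] :=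
    Sum.elim (Sum.elim 0 fun _ => -(z / (lam * (1 - t)))) fun _ => 1 / (lam * (1 - t))
  have hr : r ᵥ* G = Pi.single (Sum.inr ()) 1 := by
    ext j
    rcases j with j | j
    · simp [r, hG, Matrix.vecMul, dotProduct, iotaScalar, iotaMat, Xmat, Matrix.mul_apply,
        Matrix.diagonal_apply]
      field_simp
      ring
    · simp [r, hG, Matrix.vecMul, dotProduct, iotaScalar, iotaMat, Xmat, Matrix.mul_apply,
        Matrix.diagonal_apply]
      field_simp
      ring
  have hcorner : G (Sum.inr ()) (Sum.inr ()) = lam := by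
    simp [hG, iotaScalar, iotaMat, Xmat, Matrix.mul_apply, Matrix.diagonal_apply]
  have hcol (a : Fin (m+1)) :
      G (Sum.inl (Sum.inl a)) (Sum.inr ()) = lam * (1 - t) / z * ξ a := by
    simp [hG, iotaScalar, iotaMat, Xmat, Matrix.mul_apply, Matrix.diagonal_apply]
    field_simp
  have hlam_le : ‖lam‖ ≤ 1 := hcorner ▸ h.1 (Sum.inr ()) (Sum.inr ())
  have hpos : 0 < ‖lam * (1 - t)‖ := norm_pos_iff.mpr (mul_ne_zero hlam hs)
  have hone : 1 ≤ ‖lam * (1 - t)‖ := by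
    have := h.norm_le_one_of_vecMul_eq_single hr (Sum.inr ())
    simpa only [r, Sum.elim_inr, norm_div, norm_one, div_le_one hpos] using this
  have hz_le : ‖z‖ ≤ ‖lam * (1 - t)‖ := by
    have := h.norm_le_one_of_vecMul_eq_single hr (Sum.inl (Sum.inr ()))
    simpa only [r, Sum.elim_inl, Sum.elim_inr, norm_neg, norm_div, div_le_one hpos] using this
  constructor
  · have hge : 1 ≤ ‖t - 1‖ := by
      rw [norm_sub_rev]
      rw [norm_mul] at hone
      exact hone.trans (mul_le_of_le_one_left (norm_nonneg _) hlam_le)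
    calc ‖t‖ = ‖(t - 1) + 1‖ := by rw [sub_add_cancel]
      _ ≤ max ‖t - 1‖ ‖(1 : ℚ_[p])‖ := Padic.nonarchimedean _ _
      _ = ‖t - 1‖ := by rw [norm_one, max_eq_left hge]
  · intro a
    have hξ := h.1 (Sum.inl (Sum.inl a)) (Sum.inr ())
    rw [hcol, norm_mul, norm_div] at hξ
    exact (le_mul_of_one_le_left (norm_nonneg _)
      ((one_le_div (norm_pos_iff.mpr hz)).mpr hz_le)).trans hξ
end

section
/- Let p be a prime, n ≥ 2 and m ≥ 1 integers, r ∈ ℤ, t ∈ ℚ_p with t ≠ 1, ξ ∈ ℚ_p^{n−1} a column vector, λ ∈ ℚ_p^×, k ∈ GL_n(ℤ_p), and y ∈ GL_n(ℚ_p). Let K_p(p^m) := { g ∈ GL_{n+1}(ℤ_p) : v_p(g_{n+1,j}) ≥ m for all 1 ≤ j ≤ n }. If λ·ι(p^r·I_n)^{−1}·X(ξ,t)·ι(p^r·I_n)·ι(k·y) ∈ K_p(p^m), then λ ∈ ℤ_p^×, r ≥ m, v_p(1−t) ≤ 0, and v_p(ξ_j) ≥ r for every 1 ≤ j ≤ n−1.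 -/
open Matrix

/-- The Hecke congruence subgroup `K_p(p^a)` of level `p^a`:
`g ∈ GL_{n+1}(ℤ_p)` with `v_p(g_{n+1,j}) ≥ a` for all `1 ≤ j ≤ n`. -/
def InHeckeCongruence (p : ℕ) [Fact p.Prime] {ι : Type*} [Fintype ι] [DecidableEq ι]
    (a : ℕ) (g : Matrix (ι ⊕ Unit) (ι ⊕ Unit) ℚ_[p]) : Prop :=
  IsGLZ p g ∧ ∀ b : ι, ‖g (Sum.inr ()) (Sum.inl b)‖ ≤ (p : ℝ) ^ (-(a : ℤ))

/-- The inverse of a matrix in `GL(ℤ_p)` has `p`-adic integer entries. -/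
theorem IsGLZ.norm_inv_apply_le_one {p : ℕ} [Fact p.Prime] {ι : Type*} [Fintype ι]
    [DecidableEq ι] {g : Matrix ι ι ℚ_[p]} (hg : IsGLZ p g) (i j : ι) : ‖g⁻¹ i j‖ ≤ 1 := by
  let G : Matrix ι ι ℤ_[p] := Matrix.of fun i j => ⟨g i j, hg.1 i j⟩
  have hG : g = (PadicInt.Coe.ringHom (p := p)).mapMatrix G := by
    ext i j
    rfl
  have hadj : g.adjugate i j = (G.adjugate i j : ℚ_[p]) := by
    rw [hG, ← RingHom.map_adjugate]
    rfl
  rw [Matrix.inv_def, Ring.inverse_eq_inv', Matrix.smul_apply, smul_eq_mul, norm_mul, norm_inv,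
    hg.2, inv_one, one_mul, hadj]
  exact PadicInt.norm_le_one _

/-- A finite sum of products of a `p`-adic number of norm at most `C` and a `p`-adic integer has
norm at most `C`. -/
theorem padic_norm_sum_mul_le {p : ℕ} [Fact p.Prime] {ι : Type*} [Fintype ι] {C : ℝ}
    (hC : 0 ≤ C) {f f' : ι → ℚ_[p]} (hf : ∀ i, ‖f i‖ ≤ C) (hf' : ∀ i, ‖f' i‖ ≤ 1) :
    ‖∑ i, f i * f' i‖ ≤ C := by
  refine IsUltrametricDist.norm_sum_le_of_forall_le_of_nonneg hC fun i _ => ?_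
  rw [norm_mul]
  exact mul_le_of_le_one_right (norm_nonneg _) (hf' i) |>.trans (hf i)

/-- If two `p`-adic numbers add up to `1` and the second has norm less than `1`, then the first
has norm `1`. -/
theorem padic_norm_eq_one_of_add_eq_one {p : ℕ} [Fact p.Prime] {x y : ℚ_[p]} (h : x + y = 1)
    (hy : ‖y‖ < 1) : ‖x‖ = 1 := by
  have h1 : ‖(1 : ℚ_[p]) + -x‖ < ‖(1 : ℚ_[p])‖ := by
    rwa [← h, add_neg_cancel_comm, h, norm_one]
  rw [← norm_neg, ← Padic.norm_eq_of_norm_add_lt_left h1, norm_one]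

/-- case (4) of the proof of Lemma 9.4, places dividing the level: if
`λ·ι(p^r·I_n)⁻¹·X(ξ,t)·ι(p^r·I_n)·ι(k·y) ∈ K_p(p^a)` then `λ ∈ ℤ_p^×`, `r ≥ a`,
`v_p(1-t) ≤ 0` (stated as `1 ≤ ‖1-t‖`) and `v_p(ξ_j) ≥ r` for all `j`. -/
theorem stmt10 (p : ℕ) [Fact p.Prime] (m : ℕ) (a : ℕ) (ha : 1 ≤ a) (r : ℤ)
    (t : ℚ_[p]) (ht : t ≠ 1) (ξ : Fin (m+1) → ℚ_[p]) (lam : ℚ_[p]) (hlam : lam ≠ 0)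
    (k : Matrix (Fin (m+1) ⊕ Unit) (Fin (m+1) ⊕ Unit) ℚ_[p]) (hk : IsGLZ p k)
    (y : Matrix (Fin (m+1) ⊕ Unit) (Fin (m+1) ⊕ Unit) ℚ_[p]) (hy : IsUnit y.det)
    (h : InHeckeCongruence p a
      (lam • (iotaScalar p ((p : ℚ_[p]) ^ (-r)) * Xmat p ξ t *
        iotaScalar p ((p : ℚ_[p]) ^ r) * iotaMat p (k * y)))) :
    ‖lam‖ = 1 ∧ (a : ℤ) ≤ r ∧ 1 ≤ ‖1 - t‖ ∧ ∀ j, ‖ξ j‖ ≤ (p : ℝ) ^ (-r) := by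
  obtain ⟨hg, hrow⟩ := h
  set z : ℚ_[p] := (p : ℚ_[p]) ^ r with hz
  have hp : (p : ℚ_[p]) ≠ 0 := Nat.cast_ne_zero.mpr (Fact.out : p.Prime).ne_zero
  have hp1 : (1 : ℝ) < p := Nat.one_lt_cast.mpr (Fact.out : p.Prime).one_lt
  have hz0 : z ≠ 0 := zpow_ne_zero _ hp
  have hznorm : ‖z‖ = (p : ℝ) ^ (-r) := Padic.norm_p_zpow r
  rw [_root_.zpow_neg, ← hz] at hg hrow
  set g := lam • (iotaScalar p z⁻¹ * Xmat p ξ t * iotaScalar p z * iotaMat p (k * y)) with hgdef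
  have hlast (b) : g (Sum.inr ()) (Sum.inl b) = z * g (Sum.inl (Sum.inr ())) (Sum.inl b) := by
    simp [hgdef, iotaScalar, iotaMat, Xmat, Matrix.mul_apply (N := Matrix.fromBlocks _ _ _ _),
      Fintype.sum_sum_type]
    field_simp
  have hcorner : g (Sum.inr ()) (Sum.inr ()) = lam := by
    simp [hgdef, iotaScalar, iotaMat, Xmat, Matrix.mul_apply (N := Matrix.fromBlocks _ _ _ _),
      Fintype.sum_sum_type]
  have hright : g (Sum.inl (Sum.inr ())) (Sum.inr ()) = lam * (z⁻¹ * t) := by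
    simp [hgdef, iotaScalar, iotaMat, Xmat, Matrix.mul_apply (N := Matrix.fromBlocks _ _ _ _),
      Fintype.sum_sum_type]
  have hxi (j) : g (Sum.inl (Sum.inl j)) (Sum.inr ()) = lam * (z⁻¹ * ((1 - t) * ξ j)) := by
    simp [hgdef, iotaScalar, iotaMat, Xmat, Matrix.mul_apply (N := Matrix.fromBlocks _ _ _ _),
      Fintype.sum_sum_type]
  clear_value g
  set C : ℝ := (p : ℝ) ^ (-(a : ℤ)) with hC
  have hC0 : 0 ≤ C := by positivity
  have hC1 : C < 1 := zpow_lt_one_of_neg₀ hp1 (by omega)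
  have hinv := hg.norm_inv_apply_le_one
  have hmul : g * g⁻¹ = 1 := Matrix.mul_nonsing_inv _ <| isUnit_iff_ne_zero.mpr fun h0 => by
    have := hg.2
    simp [h0] at this
  -- The bottom row of `g` modulo `p` is `(0, …, 0, lam)`.
  have hlam1 : ‖lam‖ = 1 := by
    have e := congrFun₂ hmul (Sum.inr ()) (Sum.inr ())
    rw [Matrix.mul_apply, Fintype.sum_sum_type, Finset.univ_unique (α := Unit), Finset.sum_singleton,
      Matrix.one_apply_eq, add_comm] at e
    have e1 := padic_norm_eq_one_of_add_eq_one e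
      ((padic_norm_sum_mul_le hC0 hrow fun i => hinv _ _).trans_lt hC1)
    have hle : ‖lam‖ ≤ 1 := hcorner ▸ hg.1 (Sum.inr ()) (Sum.inr ())
    rw [norm_mul, PUnit.default_eq_unit, hcorner] at e1
    nlinarith [hinv (Sum.inr ()) (Sum.inr ()), norm_nonneg lam]
  set v := g⁻¹ (Sum.inr ()) (Sum.inl (Sum.inr ()))
  set S := ∑ b, g (Sum.inl (Sum.inr ())) (Sum.inl b) * g⁻¹ (Sum.inl b) (Sum.inl (Sum.inr ()))
    with hS
  have e1 : S + lam * (z⁻¹ * t) * v = 1 := by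
    have e := congrFun₂ hmul (Sum.inl (Sum.inr ())) (Sum.inl (Sum.inr ()))
    rwa [Matrix.mul_apply, Fintype.sum_sum_type, Finset.univ_unique (α := Unit), Finset.sum_singleton,
      Matrix.one_apply_eq, PUnit.default_eq_unit, hright] at e
  have hzS : z * S = ∑ b, g (Sum.inr ()) (Sum.inl b) * g⁻¹ (Sum.inl b) (Sum.inl (Sum.inr ())) := by
    simp only [hS, Finset.mul_sum, hlast, mul_assoc]
  have e2 : z * S + lam * v = 0 := by
    have e := congrFun₂ hmul (Sum.inr ()) (Sum.inl (Sum.inr ()))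
    rwa [Matrix.mul_apply, Fintype.sum_sum_type, Finset.univ_unique (α := Unit), Finset.sum_singleton,
      Matrix.one_apply_ne Sum.inr_ne_inl, PUnit.default_eq_unit, hcorner, ← hzS] at e
  have hzS_le : ‖z * S‖ ≤ C := hzS ▸ padic_norm_sum_mul_le hC0 hrow fun i => hinv _ _
  have hv_eq : ‖v‖ = ‖z * S‖ := by
    rw [eq_neg_of_add_eq_zero_left e2, norm_neg, norm_mul, hlam1, one_mul]
  have hS1 : ‖S‖ = 1 := by
    refine padic_norm_eq_one_of_add_eq_one e1 ?_
    rw [← hright, norm_mul]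
    exact (mul_le_of_le_one_left (norm_nonneg _) (hg.1 _ _)).trans_lt
      ((hv_eq.trans_le hzS_le).trans_lt hC1)
  have hvz : ‖v‖ = ‖z‖ := by rw [hv_eq, norm_mul, hS1, mul_one]
  have hz_pos : 0 < ‖z‖ := norm_pos_iff.mpr hz0
  have ht1 : ‖1 - t‖ = 1 := by
    have e : (1 - t) * (lam * v) = -z := by
      field_simp at e1
      linear_combination e2 - e1
    have e' := congrArg norm e
    rw [norm_mul, norm_mul, hlam1, one_mul, hvz, norm_neg] at e'
    exact mul_right_cancel₀ hz_pos.ne' (e'.trans (one_mul _).symm)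
  refine ⟨hlam1, ?_, ht1.ge, fun j => ?_⟩
  · have hzC : ‖z‖ ≤ C := by simpa [norm_mul, hS1] using hzS_le
    rw [hznorm, hC, zpow_le_zpow_iff_right₀ hp1] at hzC
    omega
  · have hj := hg.1 (Sum.inl (Sum.inl j)) (Sum.inr ())
    rw [hxi, norm_mul, norm_mul, norm_mul, hlam1, ht1, one_mul, one_mul, norm_inv,
      inv_mul_le_one₀ hz_pos] at hj
    exact hj.trans hznorm.le
end

section
/- Let p be a prime, n ≥ 2 and l ≥ 1 integers, t ∈ ℚ_p with t ≠ 1, and ξ ∈ ℚ_p^{n−1} a column vector. Suppose there exist λ, z ∈ ℚ_p^×, k ∈ GL_n(ℤ_p) and y ∈ GL_n(ℚ_p) such that λ·ι(z·I_n)^{−1}·X(ξ,t)·ι(z·I_n)·ι(k·y) ∈ GL_{n+1}(ℤ_p)·diag(1,…,1,p^{−l})·GL_{n+1}(ℤ_p). Then v_p(t) − v_p(t−1) ≥ −l and v_p(ξ_j) ≥ −l for every 1 ≤ j ≤ n−1. -/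
open Matrix

/-- Entrywise bounds multiply under the matrix product, by the ultrametric inequality. -/
theorem norm_mul_apply_le_of_forall_le {p : ℕ} [Fact p.Prime] {ι κ ν : Type*} [Fintype κ]
    {A : Matrix ι κ ℚ_[p]} {B : Matrix κ ν ℚ_[p]} {a b : ℝ} (ha : 0 ≤ a) (hb : 0 ≤ b)
    (hA : ∀ i j, ‖A i j‖ ≤ a) (hB : ∀ i j, ‖B i j‖ ≤ b) (i : ι) (j : ν) :
    ‖(A * B) i j‖ ≤ a * b := by
  rw [Matrix.mul_apply]
  refine IsUltrametricDist.norm_sum_le_of_forall_le_of_nonneg (mul_nonneg ha hb) fun c _ => ?_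
  rw [norm_mul]
  exact mul_le_mul (hA i c) (hB c j) (norm_nonneg _) ha

/-- An element of `GL(ℤ_p)` has a left inverse with `p`-adic integer entries. -/
theorem IsGLZ.exists_integral_left_inverse {p : ℕ} [Fact p.Prime] {ι : Type*} [Fintype ι]
    [DecidableEq ι] {g : Matrix ι ι ℚ_[p]} (hg : IsGLZ p g) :
    ∃ g' : Matrix ι ι ℚ_[p], (∀ i j, ‖g' i j‖ ≤ 1) ∧ g' * g = 1 := by
  let G : Matrix ι ι ℤ_[p] := Matrix.of fun i j => ⟨g i j, hg.1 i j⟩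
  have hG : G.map PadicInt.Coe.ringHom = g := by
    ext i j
    rfl
  have hdet : IsUnit G.det := by
    rw [PadicInt.isUnit_iff, PadicInt.norm_def]
    have h := RingHom.map_det (PadicInt.Coe.ringHom (p := p)) G
    rw [RingHom.mapMatrix_apply, hG] at h
    change ((G.det : ℤ_[p]) : ℚ_[p]) = _ at h
    rw [h, hg.2]
  refine ⟨G⁻¹.map PadicInt.Coe.ringHom, fun i j => (G⁻¹ i j).2, ?_⟩
  have h := congrArg (fun M => M.map (PadicInt.Coe.ringHom (p := p))) (G.nonsing_inv_mul hdet)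
  simpa only [Matrix.map_mul, hG, Matrix.map_one _ (map_zero _) (map_one _)] using h

/-- case (3) of the proof of Lemma 9.4, off-diagonal amplification: if
`λ·ι(z·I_n)⁻¹·X(ξ,t)·ι(z·I_n)·ι(k·y)` lies in the double coset
`GL_{n+1}(ℤ_p)·diag(1,…,1,p^{-l})·GL_{n+1}(ℤ_p)` then `v_p(t) - v_p(t-1) ≥ -l`
(stated as `‖t‖ ≤ p^l·‖t-1‖`) and `v_p(ξ_j) ≥ -l` (stated as `‖ξ_j‖ ≤ p^l`). -/
theorem stmt11 (p : ℕ) [Fact p.Prime] (m : ℕ) (l : ℕ) (hl : 1 ≤ l)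
    (t : ℚ_[p]) (ht : t ≠ 1) (ξ : Fin (m+1) → ℚ_[p]) (lam z : ℚ_[p])
    (hlam : lam ≠ 0) (hz : z ≠ 0)
    (k : Matrix (Fin (m+1) ⊕ Unit) (Fin (m+1) ⊕ Unit) ℚ_[p]) (hk : IsGLZ p k)
    (y : Matrix (Fin (m+1) ⊕ Unit) (Fin (m+1) ⊕ Unit) ℚ_[p]) (hy : IsUnit y.det)
    (h : ∃ k₁ k₂, IsGLZ p k₁ ∧ IsGLZ p k₂ ∧
      lam • (iotaScalar p z⁻¹ * Xmat p ξ t * iotaScalar p z * iotaMat p (k * y)) =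
        k₁ * Matrix.diagonal (Sum.elim (fun _ : Fin (m+1) ⊕ Unit => (1 : ℚ_[p]))
          (fun _ : Unit => (p : ℚ_[p]) ^ (-(l : ℤ)))) * k₂) :
    ‖t‖ ≤ (p : ℝ) ^ l * ‖t - 1‖ ∧ ∀ j, ‖ξ j‖ ≤ (p : ℝ) ^ l := by
  obtain ⟨k₁, k₂, hk₁, hk₂, hA⟩ := h
  obtain ⟨k₁', hk₁', hkk₁⟩ := hk₁.exists_integral_left_inverse
  obtain ⟨k₂', hk₂', hkk₂⟩ := hk₂.exists_integral_left_inverse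
  have hp : (p : ℚ_[p]) ≠ 0 := Nat.cast_ne_zero.2 (Fact.out : p.Prime).ne_zero
  have hp1 : (1 : ℝ) ≤ p := Nat.one_le_cast.2 (Fact.out : p.Prime).one_le
  have hpl : (1 : ℝ) ≤ (p : ℝ) ^ l := one_le_pow₀ hp1
  set w := k * y with hw
  have hwdet : w.det ≠ 0 := by
    rw [hw, Matrix.det_mul]
    refine mul_ne_zero (fun h0 => ?_) hy.ne_zero
    have := hk.2
    simp [h0] at this
  set D := Matrix.diagonal (Sum.elim (fun _ : Fin (m+1) ⊕ Unit => (1 : ℚ_[p]))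
          (fun _ : Unit => (p : ℚ_[p]) ^ (-(l : ℤ)))) with hD
  set D' := Matrix.diagonal (Sum.elim (fun _ : Fin (m+1) ⊕ Unit => (1 : ℚ_[p]))
          (fun _ : Unit => (p : ℚ_[p]) ^ l)) with hD'
  have hDD : D' * D = 1 := by
    rw [hD, hD', Matrix.diagonal_mul_diagonal, ← Matrix.diagonal_one]
    congr 1
    ext (i | i) <;> simp [hp]
  have hDle : ∀ i j, ‖D i j‖ ≤ (p : ℝ) ^ l := by
    intro i j
    rw [hD, Matrix.diagonal_apply]
    split_ifs
    · rcases i with i | i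
      · simpa using hpl
      · simp
    · simp
  have hD'le : ∀ i j, ‖D' i j‖ ≤ 1 := by
    intro i j
    rw [hD', Matrix.diagonal_apply]
    split_ifs
    · rcases i with i | i
      · simp
      · simpa using inv_le_one_of_one_le₀ hpl
    · simp
  set A := k₁ * D * k₂ with hAdef
  have hAle : ∀ i j, ‖A i j‖ ≤ (p : ℝ) ^ l := fun i j => by
    simpa using norm_mul_apply_le_of_forall_le (by positivity) zero_le_one
      (norm_mul_apply_le_of_forall_le zero_le_one (by positivity) hk₁.1 hDle) hk₂.1 i j
  set N := k₂' * D' * k₁' with hN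
  have hNle : ∀ i j, ‖N i j‖ ≤ 1 := fun i j => by
    simpa using norm_mul_apply_le_of_forall_le (by positivity) zero_le_one
      (norm_mul_apply_le_of_forall_le zero_le_one zero_le_one hk₂' hD'le) hk₁' i j
  have hNA : N * A = 1 := by
    calc N * A = k₂' * (D' * ((k₁' * k₁) * D)) * k₂ := by
          simp only [hN, hAdef, Matrix.mul_assoc]
      _ = 1 := by rw [hkk₁, Matrix.one_mul, hDD, Matrix.mul_one, hkk₂]
  -- The conjugate of `X(ξ,t)` in block form.
  set b : Fin (m+1) ⊕ Unit → ℚ_[p] := Sum.elim (fun a => (1 - t) * ξ a) (fun _ => t) with hb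
  have hM : iotaScalar p z⁻¹ * Xmat p ξ t * iotaScalar p z =
      Matrix.fromBlocks 1 (Matrix.of fun i _ => z⁻¹ * b i)
        (Matrix.of fun _ j => Sum.elim (fun _ => 0) (fun _ => z) j) 1 := by
    ext i j
    rw [iotaScalar, iotaScalar, Matrix.mul_diagonal, Matrix.diagonal_mul]
    rcases i with (i | i) | i <;> rcases j with (j | j) | j <;>
      simp [Xmat, hb, Matrix.one_apply, hz]
  rw [hM] at hA
  set M := Matrix.fromBlocks (1 : Matrix (Fin (m+1) ⊕ Unit) (Fin (m+1) ⊕ Unit) ℚ_[p])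
    (Matrix.of fun i _ => z⁻¹ * b i)
    (Matrix.of fun _ j => Sum.elim (fun _ => 0) (fun _ => z) j) (1 : Matrix Unit Unit ℚ_[p])
    with hMdef
  -- The last row of `N * M` is a multiple of the last basis vector.
  have hNM : lam • (N * M * iotaMat p w) = 1 := by
    rw [← hNA, ← hA, Matrix.mul_smul, Matrix.mul_assoc]
  have hrow : (fun c => (N * M) (Sum.inr ()) (Sum.inl c)) = 0 := by
    refine Matrix.eq_zero_of_vecMul_eq_zero hwdet ?_
    ext j
    have h := congrFun (congrFun hNM (Sum.inr ())) (Sum.inl j)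
    rw [Matrix.smul_apply, Matrix.mul_apply, Fintype.sum_sum_type] at h
    simpa [iotaMat, hlam, Matrix.vecMul, dotProduct] using h
  have hcorner : lam * (N * M) (Sum.inr ()) (Sum.inr ()) = 1 := by
    have h := congrFun (congrFun hNM (Sum.inr ())) (Sum.inr ())
    rw [Matrix.smul_apply, Matrix.mul_apply, Fintype.sum_sum_type] at h
    simpa [iotaMat] using h
  have hr0 : ∀ a, N (Sum.inr ()) (Sum.inl (Sum.inl a)) = 0 := fun a => by
    have h := congrFun hrow (Sum.inl a)
    simpa [hMdef, Matrix.mul_apply, Fintype.sum_sum_type, Matrix.one_apply] using h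
  have hr1 : N (Sum.inr ()) (Sum.inl (Sum.inr ())) + N (Sum.inr ()) (Sum.inr ()) * z = 0 := by
    have h := congrFun hrow (Sum.inr ())
    simpa [hMdef, Matrix.mul_apply, Fintype.sum_sum_type, Matrix.one_apply] using h
  have hr2 : lam * (N (Sum.inr ()) (Sum.inr ()) * (1 - t)) = 1 := by
    simp only [hMdef, Matrix.mul_apply, Fintype.sum_sum_type, hr0, hb] at hcorner
    simp at hcorner
    rw [eq_neg_of_add_eq_zero_left hr1] at hcorner
    field_simp at hcorner
    linear_combination hcorner
  have hbound : ‖z‖ ≤ ‖lam‖ * ‖1 - t‖ := by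
    have h1 : z = -N (Sum.inr ()) (Sum.inl (Sum.inr ())) * (lam * (1 - t)) := by
      linear_combination (-z) * hr2 - lam * (1 - t) * (-hr1)
    calc ‖z‖ = ‖N (Sum.inr ()) (Sum.inl (Sum.inr ()))‖ * (‖lam‖ * ‖1 - t‖) := by
          conv_lhs => rw [h1]
          rw [norm_mul, norm_neg, norm_mul]
      _ ≤ _ := mul_le_of_le_one_left (by positivity) (hNle _ _)
  -- The last column of `A`.
  have hcol : ∀ i, ‖lam‖ * ‖b i‖ ≤ (p : ℝ) ^ l * ‖z‖ := fun i => by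
    have h := congrFun (congrFun hA (Sum.inl i)) (Sum.inr ())
    rw [Matrix.smul_apply, Matrix.mul_apply, Fintype.sum_sum_type] at h
    simp [iotaMat, hMdef] at h
    have hle := hAle (Sum.inl i) (Sum.inr ())
    rw [← h, norm_mul, norm_mul, norm_inv] at hle
    have hz' : 0 < ‖z‖ := norm_pos_iff.2 hz
    calc ‖lam‖ * ‖b i‖ = ‖lam‖ * (‖z‖⁻¹ * ‖b i‖) * ‖z‖ := by field_simp
      _ ≤ _ := mul_le_mul_of_nonneg_right hle hz'.le
  have hlam' : 0 < ‖lam‖ := norm_pos_iff.2 hlam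
  have ht' : 0 < ‖1 - t‖ := norm_pos_iff.2 (sub_ne_zero.2 ht.symm)
  have hb_le : ∀ i, ‖b i‖ ≤ (p : ℝ) ^ l * ‖1 - t‖ := fun i => by
    refine le_of_mul_le_mul_left ?_ hlam'
    calc ‖lam‖ * ‖b i‖ ≤ (p : ℝ) ^ l * ‖z‖ := hcol i
      _ ≤ (p : ℝ) ^ l * (‖lam‖ * ‖1 - t‖) := by gcongr
      _ = _ := by ring
  refine ⟨?_, fun j => ?_⟩
  · rw [norm_sub_rev]
    exact hb_le (Sum.inr ())
  · have h := hb_le (Sum.inl j)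
    simp only [hb, Sum.elim_inl, norm_mul] at h
    rw [mul_comm] at h
    exact le_of_mul_le_mul_right h ht'
end

section
/- Let p be a prime, n ≥ 2 and i ≥ 1 integers, t ∈ ℚ_p with t ≠ 1, and ξ ∈ ℚ_p^{n−1} a column vector. Suppose there exist λ, z ∈ ℚ_p^×, k ∈ GL_n(ℤ_p) and y ∈ GL_n(ℚ_p) such that λ·ι(z·I_n)^{−1}·X(ξ,t)·ι(z·I_n)·ι(k·y) ∈ GL_{n+1}(ℤ_p)·diag(p^i,1,…,1,p^{−i})·GL_{n+1}(ℤ_p). Then v_p(t) − v_p(t−1) ≥ −2i and v_p(ξ_j) ≥ −2i for every 1 ≤ j ≤ n−1. -/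
open Matrix

theorem norm_mul_apply_le {p : ℕ} [Fact p.Prime] {ι : Type*} [Fintype ι]
    {A B : Matrix ι ι ℚ_[p]} {a b : ℝ} (ha : 0 ≤ a) (hb : 0 ≤ b)
    (hA : ∀ i j, ‖A i j‖ ≤ a) (hB : ∀ i j, ‖B i j‖ ≤ b) (i j : ι) :
    ‖(A * B) i j‖ ≤ a * b := by
  rw [Matrix.mul_apply]
  refine IsUltrametricDist.norm_sum_le_of_forall_le_of_nonneg (by positivity) fun l _ => ?_
  rw [norm_mul]
  exact mul_le_mul (hA i l) (hB l j) (norm_nonneg _) ha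

theorem norm_det_le_one {p : ℕ} [Fact p.Prime] {ι : Type*} [Fintype ι] [DecidableEq ι]
    {A : Matrix ι ι ℚ_[p]} (hA : ∀ i j, ‖A i j‖ ≤ 1) : ‖A.det‖ ≤ 1 := by
  rw [Matrix.det_apply']
  refine IsUltrametricDist.norm_sum_le_of_forall_le_of_nonneg zero_le_one fun σ _ => ?_
  rw [norm_mul, norm_prod]
  exact mul_le_one₀ (Padic.norm_int_le_one _) (Finset.prod_nonneg fun _ _ => norm_nonneg _)
    (Finset.prod_le_one (fun _ _ => norm_nonneg _) fun _ _ => hA _ _)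

namespace IsGLZ

variable {p : ℕ} [Fact p.Prime] {ι : Type*} [Fintype ι] [DecidableEq ι] {A : Matrix ι ι ℚ_[p]}

theorem isUnit_det_s12 (hA : IsGLZ p A) : IsUnit A.det := by
  rw [isUnit_iff_ne_zero, ← norm_ne_zero_iff, hA.2]
  exact one_ne_zero

theorem norm_inv_apply_le_one_s12 (hA : IsGLZ p A) (i j : ι) : ‖A⁻¹ i j‖ ≤ 1 := by
  rw [Matrix.inv_def, Matrix.smul_apply, smul_eq_mul, norm_mul, Ring.inverse_eq_inv', norm_inv,
    hA.2, inv_one, one_mul, Matrix.adjugate_apply]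
  refine norm_det_le_one fun a b => ?_
  rw [Matrix.updateRow_apply]
  split_ifs
  · rw [Pi.single_apply]
    split_ifs <;> simp
  · exact hA.1 a b

end IsGLZ

theorem norm_diagonal_apply_le {p : ℕ} [Fact p.Prime] {ι : Type*} [DecidableEq ι]
    {d : ι → ℚ_[p]} {a : ℝ} (ha : 0 ≤ a) (hd : ∀ i, ‖d i‖ ≤ a) (i j : ι) :
    ‖Matrix.diagonal d i j‖ ≤ a := by
  rw [Matrix.diagonal_apply]
  split_ifs
  · exact hd i
  · simpa using ha

/-- An element of the double coset of a diagonal matrix `d`, and its inverse, have entries bounded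
by any common bound for the entries of `d` and `d⁻¹`. -/
theorem exists_right_inverse_of_cartan {p : ℕ} [Fact p.Prime] {ι : Type*} [Fintype ι]
    [DecidableEq ι] {k₁ k₂ : Matrix ι ι ℚ_[p]} (h₁ : IsGLZ p k₁) (h₂ : IsGLZ p k₂)
    {d : ι → ℚ_[p]} (hd0 : ∀ i, d i ≠ 0) {a : ℝ} (ha : 0 ≤ a)
    (hd : ∀ i, ‖d i‖ ≤ a) (hd' : ∀ i, ‖(d i)⁻¹‖ ≤ a) :
    (∀ i j, ‖(k₁ * Matrix.diagonal d * k₂) i j‖ ≤ a) ∧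
      ∃ H : Matrix ι ι ℚ_[p], k₁ * Matrix.diagonal d * k₂ * H = 1 ∧ ∀ i j, ‖H i j‖ ≤ a := by
  have bound : ∀ {u v : Matrix ι ι ℚ_[p]} {e : ι → ℚ_[p]}, (∀ i j, ‖u i j‖ ≤ 1) →
      (∀ i j, ‖v i j‖ ≤ 1) → (∀ i, ‖e i‖ ≤ a) →
      ∀ i j, ‖(u * Matrix.diagonal e * v) i j‖ ≤ a := by
    intro u v e hu hv he i j
    simpa using norm_mul_apply_le (mul_nonneg zero_le_one ha) zero_le_one
      (norm_mul_apply_le zero_le_one ha hu (norm_diagonal_apply_le ha he)) hv i j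
  refine ⟨bound h₁.1 h₂.1 hd, k₂⁻¹ * Matrix.diagonal (fun i => (d i)⁻¹) * k₁⁻¹, ?_,
    bound h₂.norm_inv_apply_le_one_s12 h₁.norm_inv_apply_le_one_s12 hd'⟩
  have hdd : Matrix.diagonal d * Matrix.diagonal (fun i => (d i)⁻¹) = 1 := by
    rw [Matrix.diagonal_mul_diagonal, ← Matrix.diagonal_one]
    congr 1
    funext i
    exact mul_inv_cancel₀ (hd0 i)
  calc k₁ * Matrix.diagonal d * k₂ * (k₂⁻¹ * Matrix.diagonal (fun i => (d i)⁻¹) * k₁⁻¹)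
      = k₁ * (Matrix.diagonal d * (k₂ * k₂⁻¹) * Matrix.diagonal (fun i => (d i)⁻¹)) * k₁⁻¹ := by
        simp only [Matrix.mul_assoc]
    _ = 1 := by
        rw [Matrix.mul_nonsing_inv _ h₂.isUnit_det_s12, Matrix.mul_one, hdd, Matrix.mul_one,
          Matrix.mul_nonsing_inv _ h₁.isUnit_det_s12]

/-- The conjugate of `X(ξ,t)` by `ι(z)`, times `ι(Y)`: its last column. -/
theorem conj_Xmat_mul_iotaMat_last_col {p : ℕ} [Fact p.Prime] {m : ℕ}
    (ξ : Fin (m+1) → ℚ_[p]) (t z : ℚ_[p])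
    (Y : Matrix (Fin (m+1) ⊕ Unit) (Fin (m+1) ⊕ Unit) ℚ_[p]) (a : Fin (m+1) ⊕ Unit) :
    (iotaScalar p z⁻¹ * Xmat p ξ t * iotaScalar p z * iotaMat p Y : Matrix _ _ ℚ_[p])
        (Sum.inl a) (Sum.inr ()) =
      z⁻¹ * Xmat p ξ t (Sum.inl a) (Sum.inr ()) := by
  rw [Matrix.mul_apply]
  simp [iotaScalar, iotaMat, Fintype.sum_sum_type]

/-- The last row minus `z` times the `n`-th row is supported on the last column. -/
theorem conj_Xmat_mul_iotaMat_row_sub {p : ℕ} [Fact p.Prime] {m : ℕ}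
    (ξ : Fin (m+1) → ℚ_[p]) (t : ℚ_[p]) {z : ℚ_[p]} (hz : z ≠ 0)
    (Y : Matrix (Fin (m+1) ⊕ Unit) (Fin (m+1) ⊕ Unit) ℚ_[p]) (l : (Fin (m+1) ⊕ Unit) ⊕ Unit) :
    (iotaScalar p z⁻¹ * Xmat p ξ t * iotaScalar p z * iotaMat p Y : Matrix _ _ ℚ_[p]) (Sum.inr ()) l -
      z * (iotaScalar p z⁻¹ * Xmat p ξ t * iotaScalar p z * iotaMat p Y : Matrix _ _ ℚ_[p])
        (Sum.inl (Sum.inr ())) l = if l = Sum.inr () then 1 - t else 0 := by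
  rw [Matrix.mul_apply, Matrix.mul_apply]
  rcases l with l | l <;>
    simp [iotaScalar, iotaMat, Fintype.sum_sum_type, Xmat, hz]

/-- case (3) of the proof of Lemma 9.4, diagonal amplification: if
`λ·ι(z·I_n)⁻¹·X(ξ,t)·ι(z·I_n)·ι(k·y)` lies in the double coset
`GL_{n+1}(ℤ_p)·diag(p^i,1,…,1,p^{-i})·GL_{n+1}(ℤ_p)` then `v_p(t) - v_p(t-1) ≥ -2i`
(stated as `‖t‖ ≤ p^{2i}·‖t-1‖`) and `v_p(ξ_j) ≥ -2i` (stated as `‖ξ_j‖ ≤ p^{2i}`). -/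
theorem stmt12 (p : ℕ) [Fact p.Prime] (m : ℕ) (i : ℕ) (hi : 1 ≤ i)
    (t : ℚ_[p]) (ht : t ≠ 1) (ξ : Fin (m+1) → ℚ_[p]) (lam z : ℚ_[p])
    (hlam : lam ≠ 0) (hz : z ≠ 0)
    (k : Matrix (Fin (m+1) ⊕ Unit) (Fin (m+1) ⊕ Unit) ℚ_[p]) (hk : IsGLZ p k)
    (y : Matrix (Fin (m+1) ⊕ Unit) (Fin (m+1) ⊕ Unit) ℚ_[p]) (hy : IsUnit y.det)
    (h : ∃ k₁ k₂, IsGLZ p k₁ ∧ IsGLZ p k₂ ∧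
      lam • (iotaScalar p z⁻¹ * Xmat p ξ t * iotaScalar p z * iotaMat p (k * y)) =
        k₁ * Matrix.diagonal (Sum.elim
          (Sum.elim (fun a : Fin (m+1) => if a = 0 then (p : ℚ_[p]) ^ i else 1)
            (fun _ : Unit => (1 : ℚ_[p])))
          (fun _ : Unit => (p : ℚ_[p]) ^ (-(i : ℤ)))) * k₂) :
    ‖t‖ ≤ (p : ℝ) ^ (2 * i) * ‖t - 1‖ ∧ ∀ j, ‖ξ j‖ ≤ (p : ℝ) ^ (2 * i) := by
  obtain ⟨k₁, k₂, h₁, h₂, hG⟩ := h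
  have hp1 : (1 : ℝ) ≤ p := by exact_mod_cast (Fact.out : p.Prime).one_le
  have hpQ : (p : ℚ_[p]) ≠ 0 := by exact_mod_cast (Fact.out : p.Prime).ne_zero
  have hpi : (1 : ℝ) ≤ (p : ℝ) ^ i := one_le_pow₀ hp1
  have hpi' : ((p : ℝ) ^ i)⁻¹ ≤ (p : ℝ) ^ i := (inv_le_one_of_one_le₀ hpi).trans hpi
  obtain ⟨hle, H, hH, hHle⟩ := exists_right_inverse_of_cartan h₁ h₂
    (d := Sum.elim (Sum.elim (fun a : Fin (m+1) => if a = 0 then (p : ℚ_[p]) ^ i else 1)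
      (fun _ : Unit => (1 : ℚ_[p]))) (fun _ : Unit => (p : ℚ_[p]) ^ (-(i : ℤ))))
    (a := (p : ℝ) ^ i)
    (by
      rintro ((a | a) | a)
      · by_cases h0 : a = 0 <;> simp [h0, hpQ]
      · simp
      · simp [hpQ])
    (by positivity)
    (by
      rintro ((a | a) | a)
      · by_cases h0 : a = 0 <;> simp [h0, hpi, hpi']
      · simpa using hpi
      · simp)
    (by
      rintro ((a | a) | a)
      · by_cases h0 : a = 0 <;> simp [h0, hpi]
      · simpa using hpi
      · simp [hpi'])
  rw [← hG] at hle hH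
  have hs : 0 < ‖1 - t‖ := norm_pos_iff.2 (sub_ne_zero.2 ht.symm)
  have hlam' : 0 < ‖lam‖ := norm_pos_iff.2 hlam
  have hz' : 0 < ‖z‖ := norm_pos_iff.2 hz
  have hzH : -z = lam * (1 - t) * H (Sum.inr ()) (Sum.inl (Sum.inr ())) := by
    have e₁ := congrFun (congrFun hH (Sum.inr ())) (Sum.inl (Sum.inr ()))
    have e₂ := congrFun (congrFun hH (Sum.inl (Sum.inr ()))) (Sum.inl (Sum.inr ()))
    rw [Matrix.mul_apply, Matrix.one_apply_ne (by simp)] at e₁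
    rw [Matrix.mul_apply, Matrix.one_apply_eq] at e₂
    have e₃ : -z = 0 - z * 1 := by ring
    rw [e₃]
    conv_lhs => rw [← e₁, ← e₂]
    rw [Finset.mul_sum, ← Finset.sum_sub_distrib]
    rw [Finset.sum_congr rfl (g := fun l => lam * (if l = Sum.inr () then 1 - t else 0) *
      H l (Sum.inl (Sum.inr ())))]
    · simp
    · intro l _
      rw [← conj_Xmat_mul_iotaMat_row_sub ξ t hz (k * y) l]
      simp only [Matrix.smul_apply, smul_eq_mul]
      ring
  have hzle : ‖z‖ ≤ ‖lam‖ * ‖1 - t‖ * (p : ℝ) ^ i := by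
    rw [← norm_neg z, hzH, norm_mul, norm_mul]
    exact mul_le_mul_of_nonneg_left (hHle _ _) (by positivity)
  have key : ∀ a, ‖Xmat p ξ t (Sum.inl a) (Sum.inr ())‖ ≤ (p : ℝ) ^ (2 * i) * ‖1 - t‖ := by
    intro a
    have h' := hle (Sum.inl a) (Sum.inr ())
    rw [Matrix.smul_apply, conj_Xmat_mul_iotaMat_last_col, smul_eq_mul, norm_mul, norm_mul,
      norm_inv] at h'
    refine le_of_mul_le_mul_left ?_ hlam'
    calc ‖lam‖ * ‖Xmat p ξ t (Sum.inl a) (Sum.inr ())‖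
        = ‖lam‖ * (‖z‖⁻¹ * ‖Xmat p ξ t (Sum.inl a) (Sum.inr ())‖) * ‖z‖ := by
          field_simp
      _ ≤ (p : ℝ) ^ i * (‖lam‖ * ‖1 - t‖ * (p : ℝ) ^ i) :=
          mul_le_mul h' hzle hz'.le (by positivity)
      _ = ‖lam‖ * ((p : ℝ) ^ (2 * i) * ‖1 - t‖) := by ring
  refine ⟨?_, fun j => ?_⟩
  · rw [norm_sub_rev]
    exact key (Sum.inr ())
  · refine le_of_mul_le_mul_right ?_ hs
    have hj : ‖(1 - t) * ξ j‖ ≤ (p : ℝ) ^ (2 * i) * ‖1 - t‖ := key (Sum.inl j)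
    rwa [norm_mul, mul_comm] at hj
end
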